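/- Assume V is real-valued, θ₀, θ_R ∈ [0,π), θ₀', θ_R' ∈ (0,π), and let ξ(·; H_{θ₀',θ_R'}, H_{θ₀,θ_R}) be the spectral shift function of the pair (H_{θ₀',θ_R'}, H_{θ₀,θ_R}) normalized to vanish on (−∞, e₀). Then for a.e. λ ∈ ℝ, ξ(λ; H_{θ₀',θ_R'}, H_{θ₀,θ_R}) = π^{-1} lim_{ε↓0} Im( ln( η(θ₀,θ_R) · det_{ℂ²}(Λ_{θ₀,θ_R}^{θ₀',θ_R'}(λ + iε)) ) ), where η(θ₀,θ_R) = 1 if θ₀, θ_R ∈ (0,π) or θ₀ = θ_R = 0, and η(θ₀,θ_R) = −1 if exactly one of θ₀, θ_R equals 0. -/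

import Mathlib

open MeasureTheory Filter
open scoped InnerProductSpace

noncomputable section
open scoped Classical


variable {H : Type*} [NormedAddCommGroup H] [InnerProductSpace ℂ H] [CompleteSpace H]

/-- `T` is the (bounded, everywhere defined) inverse of `A - z·I`. -/
def IsResolvent (A : H →ₗ.[ℂ] H) (z : ℂ) (T : H →L[ℂ] H) : Prop :=
  (∀ x : H, ∃ hx : T x ∈ A.domain, A ⟨T x, hx⟩ - z • T x = x) ∧
  ∀ u : A.domain, T (A u - z • (u : H)) = (u : H)

/-- The resolvent set of an unbounded operator. -/
def resolventSetP (A : H →ₗ.[ℂ] H) : Set ℂ := {z | ∃ T, IsResolvent A z T}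

/-- The spectrum of an unbounded operator. -/
def specP (A : H →ₗ.[ℂ] H) : Set ℂ := (resolventSetP A)ᶜ

/-- The resolvent `(A - z·I)⁻¹` (junk value `0` off the resolvent set). -/
def res (A : H →ₗ.[ℂ] H) (z : ℂ) : H →L[ℂ] H :=
  if h : ∃ T, IsResolvent A z T then h.choose else 0

/-- The operator `A + t·I` (same domain). -/
def shiftP (A : H →ₗ.[ℂ] H) (t : ℂ) : H →ₗ.[ℂ] H :=
  ⟨A.domain, A.toFun + t • A.domain.subtype⟩

/-- `A` is of positive type: `(-∞,0] ⊆ ρ(A)` and `sup_{t ≥ 0} ‖(1+t)(A+t)⁻¹‖ < ∞`. -/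
def IsPositiveTypeP (A : H →ₗ.[ℂ] H) : Prop :=
  (∀ x : ℝ, x ≤ 0 → (x : ℂ) ∈ resolventSetP A) ∧
  ∃ M : ℝ, ∀ t : ℝ, 0 ≤ t → (1 + t) * ‖res A (-(t : ℂ))‖ ≤ M

/-- The open sector of half-opening angle `ω` about the positive reals
(`(0,∞)` for `ω = 0`). -/
def sectorS (ω : ℝ) : Set ℂ :=
  if ω = 0 then (fun x : ℝ => (x : ℂ)) '' Set.Ioi 0
  else {z : ℂ | z ≠ 0 ∧ |Complex.arg z| < ω}

/-- `A` is sectorial of angle `ω`. -/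
def IsSectorialP (A : H →ₗ.[ℂ] H) (ω : ℝ) : Prop :=
  specP A ⊆ closure (sectorS ω) ∧
  ∀ ω' : ℝ, ω < ω' → ω' < Real.pi →
    ∃ M : ℝ, ∀ z ∈ (closure (sectorS ω'))ᶜ, ‖z‖ * ‖res A z‖ ≤ M

/-- The shifted sector `-t₀ + S_ω`. -/
def shiftedSector (t0 ω : ℝ) : Set ℂ := (fun w => -(t0 : ℂ) + w) '' sectorS ω

/-- The region `ℂ \ closure (-t₀ + S_ω)`. -/
def offSector (t0 ω : ℝ) : Set ℂ := (closure (shiftedSector t0 ω))ᶜ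

/-- The bounded operator `(A - z·I)^{-1/2}`, defined by the Balakrishnan-type formula
`(1/π) ∫₀^∞ t^{-1/2} (A + (t - z)·I)⁻¹ dt`. -/
def negSqrt (A : H →ₗ.[ℂ] H) (z : ℂ) : H →L[ℂ] H :=
  ((Real.pi : ℂ))⁻¹ • ∫ t in Set.Ioi (0 : ℝ), ((Real.sqrt t : ℂ))⁻¹ • res A (z - t)

/-- Trace-class (nuclear) bounded operators, characterized by
`sup { ∑ |⟨eᵢ, T fᵢ⟩| : (eᵢ), (fᵢ) finite orthonormal families } < ∞`. -/
def IsTraceClass (T : H →L[ℂ] H) : Prop :=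
  ∃ C : ℝ, ∀ (n : ℕ) (e f : Fin n → H), Orthonormal ℂ e → Orthonormal ℂ f →
    ∑ i, ‖⟪e i, T (f i)⟫_ℂ‖ ≤ C

/-- The trace norm `‖T‖₁`. -/
def traceNorm (T : H →L[ℂ] H) : ℝ :=
  sSup {s : ℝ | ∃ (n : ℕ) (e f : Fin n → H), Orthonormal ℂ e ∧ Orthonormal ℂ f ∧
    s = ∑ i, ‖⟪e i, T (f i)⟫_ℂ‖}

/-- The trace of a (trace-class) operator, computed in the Hilbert basis `b`. -/
def traceH (b : HilbertBasis ℕ ℂ H) (T : H →L[ℂ] H) : ℂ :=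
  ∑' n, ⟪(b n : H), T (b n)⟫_ℂ

/-- The Fredholm determinant `det (I + T)` (for `T` trace class), computed as the limit of
finite-section determinants along the Hilbert basis `b`. -/
def detI (b : HilbertBasis ℕ ℂ H) (T : H →L[ℂ] H) : ℂ :=
  limUnder atTop fun F : Finset ℕ =>
    Matrix.det (Matrix.of fun i j : F =>
      (if (i : ℕ) = (j : ℕ) then (1 : ℂ) else 0) + ⟪(b (i : ℕ) : H), T (b (j : ℕ))⟫_ℂ)


/-! ### One-dimensional Schrödinger operators on `[0,R]` -/

/-- The underlying Hilbert space `L²((0,R); dx)`. -/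
abbrev SchSp (Rr : ℝ) :=
  MeasureTheory.Lp ℂ 2 (MeasureTheory.volume.restrict (Set.Ioo (0 : ℝ) Rr))

/-- `u` (with derivative `du`) solves `-u'' + V u = z u` on `[0,R]`, with
`u, u' ∈ AC([0,R])` (the second derivative being encoded in integrated form). -/
def SolODE (Rr : ℝ) (V : ℝ → ℂ) (z : ℂ) (u du : ℝ → ℂ) : Prop :=
  (∀ x ∈ Set.Icc (0 : ℝ) Rr, HasDerivWithinAt u (du x) (Set.Icc (0 : ℝ) Rr) x) ∧
  ∀ x ∈ Set.Icc (0 : ℝ) Rr, du x = du 0 + ∫ t in (0 : ℝ)..x, (V t - z) * u t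

/-- The boundary trace `γ_{θ₀,θ_R}(u) = (cos θ₀ u(0) + sin θ₀ u'(0),
cos θ_R u(R) - sin θ_R u'(R))`. -/
def bdryC (Rr : ℝ) (t0 tR : ℂ) (u du : ℝ → ℂ) : Fin 2 → ℂ :=
  ![Complex.cos t0 * u 0 + Complex.sin t0 * du 0,
    Complex.cos tR * u Rr - Complex.sin tR * du Rr]

/-- `g` (with derivative `dg`) is an absolutely continuous representative of `f ∈ L²`
satisfying `-g'' + V g - z g = h` (in integrated form, with `h₀` a representative of
`h ∈ L²`); i.e. `f` represents `(H - z)⁻¹ h`. -/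
def SolvesAt (Rr : ℝ) (V : ℝ → ℂ) (z : ℂ) (f h : SchSp Rr) (g dg : ℝ → ℂ) : Prop :=
  (∀ᵐ x ∂(MeasureTheory.volume.restrict (Set.Ioo (0 : ℝ) Rr)), f x = g x) ∧
  (∀ x ∈ Set.Icc (0 : ℝ) Rr, HasDerivWithinAt g (dg x) (Set.Icc (0 : ℝ) Rr) x) ∧
  ∃ h0 : ℝ → ℂ,
    (∀ᵐ x ∂(MeasureTheory.volume.restrict (Set.Ioo (0 : ℝ) Rr)), h x = h0 x) ∧
    ∀ x ∈ Set.Icc (0 : ℝ) Rr,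
      dg x = dg 0 + ∫ t in (0 : ℝ)..x, (V t * g t - z * g t - h0 t)

/-- `Hop` is the Schrödinger operator `H_{θ₀,θ_R} = -d²/dx² + V` in `L²((0,R); dx)` with
separated boundary conditions `γ_{θ₀,θ_R}(g) = 0`, characterized through its graph. -/
def IsSchrodingerOp (Rr : ℝ) (V : ℝ → ℂ) (t0 tR : ℂ)
    (Hop : SchSp Rr →ₗ.[ℂ] SchSp Rr) : Prop :=
  ∀ f h : SchSp Rr, (f, h) ∈ Hop.graph ↔
    ∃ g dg : ℝ → ℂ, SolvesAt Rr V 0 f h g dg ∧ bdryC Rr t0 tR g dg = 0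

/-- `Λ` is the boundary data map `Λ_{θ₀,θ_R}^{θ₀',θ_R'}(z)`: for every solution `u` of
`-u'' + Vu = zu`, `Λ` maps `γ_{θ₀,θ_R}(u)` to `γ_{θ₀',θ_R'}(u)`. -/
def IsBoundaryDataMap (Rr : ℝ) (V : ℝ → ℂ) (t0 tR t0' tR' : ℂ) (z : ℂ)
    (Λ : Matrix (Fin 2) (Fin 2) ℂ) : Prop :=
  ∀ u du : ℝ → ℂ, SolODE Rr V z u du →
    Λ.mulVec (bdryC Rr t0 tR u du) = bdryC Rr t0' tR' u du

/-- `G` is the map `γ_{θ₀',θ_R'} ∘ (Hop - z)⁻¹ : L²((0,R)) → ℂ²`. -/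
def IsBdryResolventMap (Rr : ℝ) (V : ℝ → ℂ) (t0' tR' : ℂ) (z : ℂ)
    (Hop : SchSp Rr →ₗ.[ℂ] SchSp Rr)
    (G : SchSp Rr →L[ℂ] EuclideanSpace ℂ (Fin 2)) : Prop :=
  ∀ (h : SchSp Rr) (g dg : ℝ → ℂ), SolvesAt Rr V z (res Hop z h) h g dg →
    ∀ i : Fin 2, G h i = bdryC Rr t0' tR' g dg i

/-- The region `ℂ \ [c, ∞)`. -/
def offCut (c : ℝ) : Set ℂ := {z : ℂ | z.im ≠ 0 ∨ z.re < c}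

/-- `N` is the family `z ↦ (Hop - z)^{-1/2}`, defined via the spectral theorem with branch
cut along `[c, ∞)` (`c = inf σ(Hop)`): analytic on `ℂ \ [c,∞)`, squaring to the resolvent,
and positive (self-adjoint) for real `z < c`. -/
def IsSqrtResFam (Rr : ℝ) (Hop : SchSp Rr →ₗ.[ℂ] SchSp Rr) (c : ℝ)
    (N : ℂ → (SchSp Rr →L[ℂ] SchSp Rr)) : Prop :=
  (∀ z ∈ offCut c, (N z).comp (N z) = res Hop z) ∧
  (∀ x : ℝ, x < c →
    (∀ v w : SchSp Rr, ⟪N (x : ℂ) v, w⟫_ℂ = ⟪v, N (x : ℂ) w⟫_ℂ) ∧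
    ∀ v : SchSp Rr, 0 ≤ (⟪v, N (x : ℂ) v⟫_ℂ).re) ∧
  DifferentiableOn ℂ N (offCut c)

/-- The infimum `e₀ = inf(σ(Hop) ∪ σ(Hop'))`. -/
def einf (Rr : ℝ) (Hop Hop' : SchSp Rr →ₗ.[ℂ] SchSp Rr) : ℝ :=
  sInf {x : ℝ | (x : ℂ) ∈ specP Hop ∪ specP Hop'}

/-- The infimum of the spectrum of a single operator. -/
def einf1 (Rr : ℝ) (Hop : SchSp Rr →ₗ.[ℂ] SchSp Rr) : ℝ :=
  sInf {x : ℝ | (x : ℂ) ∈ specP Hop}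

/-! ### Calculus of primitives of integrable functions -/

/-- `F` is a primitive on `[a, b]` of the (merely integrable) function `f`. -/
def IsPrimitiveOn {E : Type*} [NormedAddCommGroup E] [NormedSpace ℝ E]
    (F f : ℝ → E) (a b : ℝ) : Prop :=
  IntervalIntegrable f volume a b ∧ ∀ x ∈ Set.Icc a b, F x = F a + ∫ t in a..x, f t

namespace IsPrimitiveOn

lemma continuousOn {E : Type*} [NormedAddCommGroup E] [NormedSpace ℝ E]
    {F f : ℝ → E} {a b : ℝ} (hab : a ≤ b) (h : IsPrimitiveOn F f a b) :
    ContinuousOn F (Set.Icc a b) := by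
  have : ContinuousOn (fun x => F a + ∫ t in a..x, f t) (Set.Icc a b) := by
    have := intervalIntegral.continuousOn_primitive_interval' h.1 Set.left_mem_uIcc
    rw [Set.uIcc_of_le hab] at this
    exact continuousOn_const.add this
  exact this.congr h.2

lemma mono {E : Type*} [NormedAddCommGroup E] [NormedSpace ℝ E]
    {F f : ℝ → E} {a b c : ℝ} (hac : a ≤ c) (hcb : c ≤ b) (h : IsPrimitiveOn F f a b) :
    IsPrimitiveOn F f a c :=
  ⟨h.1.mono_set (by
    rw [Set.uIcc_of_le hac, Set.uIcc_of_le (hac.trans hcb)]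
    exact Set.Icc_subset_Icc_right hcb), fun x hx => h.2 x ⟨hx.1, hx.2.trans hcb⟩⟩

lemma integral_mul_real {F G f g : ℝ → ℝ} {a b : ℝ} (hab : a ≤ b)
    (hF : IsPrimitiveOn F f a b) (hG : IsPrimitiveOn G g a b) :
    ∫ x in a..b, (f x * G x + F x * g x) = F b * G b - F a * G a := by
  have key : ∀ {K k : ℝ → ℝ}, IsPrimitiveOn K k a b →
      AbsolutelyContinuousOnInterval (fun x => K a + ∫ t in a..x, k t) a b ∧
      ∀ᵐ x, x ∈ Set.uIcc a b → HasDerivAt (fun x => K a + ∫ t in a..x, k t) (k x) x := by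
    intro K k hK
    constructor
    · have h1 := hK.1.absolutelyContinuousOnInterval_intervalIntegral Set.left_mem_uIcc
      have h2 : AbsolutelyContinuousOnInterval (fun _ : ℝ => K a) a b :=
        ((LipschitzWith.const (K a)).lipschitzOnWith).absolutelyContinuousOnInterval
      exact h2.add h1
    · filter_upwards [hK.1.ae_hasDerivAt_integral] with x hx hx'
      exact (hx hx' a Set.left_mem_uIcc).const_add _
  obtain ⟨hF1, hF2⟩ := key hF
  obtain ⟨hG1, hG2⟩ := key hG
  have h := hF1.integral_deriv_mul_eq_sub hG1
  rw [hF.2 b ⟨hab, le_rfl⟩, hG.2 b ⟨hab, le_rfl⟩]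
  simp only [intervalIntegral.integral_same, add_zero] at h
  rw [← h]
  apply intervalIntegral.integral_congr_ae
  filter_upwards [hF2, hG2] with x h1 h2 hx
  have hx' := Set.uIoc_subset_uIcc hx
  rw [(h1 hx').deriv, (h2 hx').deriv]
  rw [Set.uIcc_of_le hab] at hx'
  rw [hF.2 x hx', hG.2 x hx']

lemma re {F f : ℝ → ℂ} {a b : ℝ} (hF : IsPrimitiveOn F f a b) :
    IsPrimitiveOn (fun x => (F x).re) (fun x => (f x).re) a b := by
  refine ⟨⟨hF.1.1.re, hF.1.2.re⟩, fun x hx => ?_⟩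
  have hi : IntervalIntegrable f volume a x := (hF.mono hx.1 hx.2).1
  have := Complex.reCLM.intervalIntegral_comp_comm hi
  simp only [Complex.reCLM_apply] at this
  simp only [this]
  rw [hF.2 x hx, Complex.add_re]

lemma im {F f : ℝ → ℂ} {a b : ℝ} (hF : IsPrimitiveOn F f a b) :
    IsPrimitiveOn (fun x => (F x).im) (fun x => (f x).im) a b := by
  refine ⟨⟨hF.1.1.im, hF.1.2.im⟩, fun x hx => ?_⟩
  have hi : IntervalIntegrable f volume a x := (hF.mono hx.1 hx.2).1
  have := Complex.imCLM.intervalIntegral_comp_comm hi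
  simp only [Complex.imCLM_apply] at this
  simp only [this]
  rw [hF.2 x hx, Complex.add_im]

/-- Integration by parts for primitives of integrable complex functions. -/
lemma integral_mul {F G f g : ℝ → ℂ} {a b : ℝ} (hab : a ≤ b)
    (hF : IsPrimitiveOn F f a b) (hG : IsPrimitiveOn G g a b) :
    ∫ x in a..b, (f x * G x + F x * g x) = F b * G b - F a * G a := by
  have hint : ∀ {K L k l : ℝ → ℝ}, IsPrimitiveOn K k a b → IsPrimitiveOn L l a b →
      IntervalIntegrable (fun x => k x * L x + K x * l x) volume a b := by
    intro K L k l hK hL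
    have c1 := hK.continuousOn hab
    have c2 := hL.continuousOn hab
    rw [← Set.uIcc_of_le hab] at c1 c2
    exact (hK.1.mul_continuousOn c2).add (hL.1.continuousOn_mul c1)
  have hintC : IntervalIntegrable (fun x => f x * G x + F x * g x) volume a b := by
    have c1 := hF.continuousOn hab
    have c2 := hG.continuousOn hab
    rw [← Set.uIcc_of_le hab] at c1 c2
    exact (hF.1.mul_continuousOn c2).add (hG.1.continuousOn_mul c1)
  have rr := integral_mul_real hab hF.re hG.re
  have ii := integral_mul_real hab hF.im hG.im
  have ri := integral_mul_real hab hF.re hG.im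
  have ir := integral_mul_real hab hF.im hG.re
  apply Complex.ext
  · have := Complex.reCLM.intervalIntegral_comp_comm hintC
    simp only [Complex.reCLM_apply] at this
    rw [← this]
    have e : (fun x => (f x * G x + F x * g x).re) = fun x =>
        ((f x).re * (G x).re + (F x).re * (g x).re) -
          ((f x).im * (G x).im + (F x).im * (g x).im) := by
      funext x; simp only [Complex.add_re, Complex.mul_re]; ring
    rw [e, intervalIntegral.integral_sub (hint hF.re hG.re) (hint hF.im hG.im), rr, ii]
    simp only [Complex.sub_re, Complex.mul_re]; ring
  · have := Complex.imCLM.intervalIntegral_comp_comm hintC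
    simp only [Complex.imCLM_apply] at this
    rw [← this]
    have e : (fun x => (f x * G x + F x * g x).im) = fun x =>
        ((f x).re * (G x).im + (F x).re * (g x).im) +
          ((f x).im * (G x).re + (F x).im * (g x).re) := by
      funext x; simp only [Complex.add_im, Complex.mul_im]; ring
    rw [e, intervalIntegral.integral_add (hint hF.re hG.im) (hint hF.im hG.re), ri, ir]
    simp only [Complex.sub_im, Complex.mul_im]; ring

/-- A `C¹` function is a primitive of its derivative. -/
lemma of_hasDerivWithinAt {F f : ℝ → ℂ} {a b : ℝ} (hab : a ≤ b)
    (hF : ∀ x ∈ Set.Icc a b, HasDerivWithinAt F (f x) (Set.Icc a b) x)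
    (hf : ContinuousOn f (Set.Icc a b)) : IsPrimitiveOn F f a b := by
  have hi : IntervalIntegrable f volume a b := by
    apply ContinuousOn.intervalIntegrable
    rwa [Set.uIcc_of_le hab]
  refine ⟨hi, fun x hx => ?_⟩
  rw [intervalIntegral.integral_eq_sub_of_hasDerivAt_of_le hx.1
    (fun y hy => ((hF y ⟨hy.1, hy.2.trans hx.2⟩).continuousWithinAt.mono
      (Set.Icc_subset_Icc_right hx.2)))
    (fun y hy => (hF y ⟨hy.1.le, hy.2.le.trans hx.2⟩).hasDerivAt
      (Icc_mem_nhds hy.1 (hy.2.trans_le hx.2)))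
    (hi.mono_set (by
      rw [Set.uIcc_of_le hx.1, Set.uIcc_of_le hab]; exact Set.Icc_subset_Icc_right hx.2))]
  ring

end IsPrimitiveOn

/-! ### Boundary values of Poisson integrals -/

lemma integrable_sq_div_sq : Integrable (fun s : ℝ => 2 * s ^ 2 / (1 + s ^ 2) ^ 2) := by
  refine (integrable_inv_one_add_sq.const_mul 2).mono' ?_ ?_
  · exact (by fun_prop (disch := intro x; positivity) :
      Continuous (fun s : ℝ => 2 * s ^ 2 / (1 + s ^ 2) ^ 2)).aestronglyMeasurable
  · refine ae_of_all _ fun s => ?_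
    rw [Real.norm_of_nonneg (by positivity), div_le_iff₀ (by positivity)]
    have : (2 : ℝ) * (1 + s ^ 2)⁻¹ * (1 + s ^ 2) ^ 2 = 2 * (1 + s ^ 2) := by field_simp
    rw [this]; nlinarith

lemma integral_sq_div_sq : ∫ s : ℝ, 2 * s ^ 2 / (1 + s ^ 2) ^ 2 = Real.pi := by
  have hd : ∀ s : ℝ, HasDerivAt (fun s : ℝ => Real.arctan s - s / (1 + s ^ 2))
      (2 * s ^ 2 / (1 + s ^ 2) ^ 2) s := by
    intro s
    have h1 := Real.hasDerivAt_arctan s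
    have h2 : HasDerivAt (fun s : ℝ => 1 + s ^ 2) (2 * s) s := by
      simpa using ((hasDerivAt_id s).pow 2).const_add 1
    have h3 := h1.sub ((hasDerivAt_id s).div h2 (by positivity))
    convert! h3 using 1
    simp only [id]
    field_simp
    ring
  have hlim : Tendsto (fun s : ℝ => s / (1 + s ^ 2)) (cocompact ℝ) (nhds 0) := by
    have hb : Tendsto (fun s : ℝ => ‖s‖⁻¹) (cocompact ℝ) (nhds 0) :=
      tendsto_inv_atTop_zero.comp tendsto_norm_cocompact_atTop
    refine squeeze_zero_norm (fun s => ?_) hb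
    rcases eq_or_ne s 0 with rfl | hs
    · simp
    · have hs' : 0 < ‖s‖ := norm_pos_iff.mpr hs
      have h1 : ‖1 + s ^ 2‖ = 1 + ‖s‖ ^ 2 := by
        rw [Real.norm_of_nonneg (by positivity), Real.norm_eq_abs, sq_abs]
      rw [norm_div, h1, div_le_iff₀ (by positivity)]
      field_simp
      nlinarith
  rw [cocompact_eq_atBot_atTop, tendsto_sup] at hlim
  have := integral_of_hasDerivAt_of_tendsto hd integrable_sq_div_sq
    ((Real.tendsto_arctan_atBot.mono_right nhdsWithin_le_nhds).sub hlim.1)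
    ((Real.tendsto_arctan_atTop.mono_right nhdsWithin_le_nhds).sub hlim.2)
  rw [this]; ring

lemma locallyIntegrable_of_integrable_div {ξ : ℝ → ℝ}
    (h : Integrable (fun t : ℝ => ξ t / (t ^ 2 + 1))) : LocallyIntegrable ξ := by
  have h1 : LocallyIntegrable (fun t : ℝ => (t ^ 2 + 1) * (ξ t / (t ^ 2 + 1))) := by
    have := (locallyIntegrableOn_univ.mpr h.locallyIntegrable).continuousOn_mul
      (g := fun t : ℝ => t ^ 2 + 1) (by fun_prop) isOpen_univ.isLocallyClosed
    exact locallyIntegrableOn_univ.mp this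
  convert! h1 using 2 with t
  have : t ^ 2 + 1 ≠ 0 := by positivity
  field_simp

/-- The scaled primitive converges after integration against the derivative of the
Poisson kernel. -/
lemma tendsto_integral_scaled {Φ : ℝ → ℝ} {x c δ : ℝ} (hδ : 0 < δ) {C : ℝ}
    (hΦ : HasDerivAt Φ c x) (hx : Φ x = 0)
    (hcont : ContinuousOn Φ (Set.Icc (x - δ) (x + δ)))
    (hC : ∀ y ∈ Set.Icc (x - δ) (x + δ), |Φ y| ≤ C * |y - x|) :
    Tendsto (fun ε : ℝ => ∫ y in (x - δ)..(x + δ), Φ y *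
      (2 * ε * (y - x) / ((y - x) ^ 2 + ε ^ 2) ^ 2)) (nhdsWithin 0 (Set.Ioi 0))
      (nhds (Real.pi * c)) := by
  have hsub : ∀ ε : ℝ, 0 < ε → ∫ y in (x - δ)..(x + δ), Φ y *
      (2 * ε * (y - x) / ((y - x) ^ 2 + ε ^ 2) ^ 2) =
      ∫ s : ℝ, (Set.Ioc (-(δ / ε)) (δ / ε)).indicator
        (fun s => Φ (x + ε * s) / ε * (2 * s / (1 + s ^ 2) ^ 2)) s := by
    intro ε hε
    rw [integral_indicator measurableSet_Ioc,
      ← intervalIntegral.integral_of_le (by have : 0 < δ / ε := by positivity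
                                            linarith)]
    have h := intervalIntegral.integral_comp_add_mul (a := -(δ / ε)) (b := δ / ε)
      (fun y => Φ y * (2 * ε * (y - x) / ((y - x) ^ 2 + ε ^ 2) ^ 2)) hε.ne' x
    have e1 : x + ε * -(δ / ε) = x - δ := by field_simp; ring
    have e2 : x + ε * (δ / ε) = x + δ := by field_simp
    rw [e1, e2] at h
    have h' : ∫ y in (x - δ)..(x + δ), Φ y *
      (2 * ε * (y - x) / ((y - x) ^ 2 + ε ^ 2) ^ 2) = ε * ∫ s in -(δ / ε)..(δ / ε),
        (fun y => Φ y * (2 * ε * (y - x) / ((y - x) ^ 2 + ε ^ 2) ^ 2)) (x + ε * s) := by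
      rw [h, smul_eq_mul, mul_inv_cancel_left₀ hε.ne']
    rw [h', ← intervalIntegral.integral_const_mul]
    refine intervalIntegral.integral_congr fun s _ => ?_
    have : (x + ε * s - x) ^ 2 + ε ^ 2 = ε ^ 2 * (1 + s ^ 2) := by ring
    simp only [this]
    have : s ^ 2 + 1 ≠ 0 := by positivity
    field_simp
    ring
  have hC0 : 0 ≤ C := by
    have := (abs_nonneg _).trans (hC (x + δ) ⟨by linarith, le_rfl⟩)
    rw [add_sub_cancel_left, abs_of_pos hδ] at this
    exact nonneg_of_mul_nonneg_left this hδ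
  have hlim : Tendsto (fun ε : ℝ => ∫ s : ℝ, (Set.Ioc (-(δ / ε)) (δ / ε)).indicator
        (fun s => Φ (x + ε * s) / ε * (2 * s / (1 + s ^ 2) ^ 2)) s)
      (nhdsWithin 0 (Set.Ioi 0)) (nhds (∫ s : ℝ, c * (2 * s ^ 2 / (1 + s ^ 2) ^ 2))) := by
    have hmem : ∀ {ε s : ℝ}, 0 < ε → s ∈ Set.Ioc (-(δ / ε)) (δ / ε) →
        x + ε * s ∈ Set.Icc (x - δ) (x + δ) := by
      intro ε s hε hs
      have e1 : ε * (δ / ε) = δ := by field_simp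
      have h1 := mul_le_mul_of_nonneg_left hs.1.le hε.le
      have h2 := mul_le_mul_of_nonneg_left hs.2 hε.le
      rw [mul_neg, e1] at h1
      rw [e1] at h2
      exact ⟨by linarith, by linarith⟩
    refine tendsto_integral_filter_of_dominated_convergence
      (fun s => C * (2 * s ^ 2 / (1 + s ^ 2) ^ 2)) ?_ ?_ (integrable_sq_div_sq.const_mul C) ?_
    · filter_upwards [self_mem_nhdsWithin] with ε hε
      have hε : 0 < ε := hε
      rw [aestronglyMeasurable_indicator_iff measurableSet_Ioc]
      refine ContinuousOn.aestronglyMeasurable ?_ measurableSet_Ioc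
      refine ContinuousOn.mul (ContinuousOn.div_const ?_ ε)
        (by fun_prop (disch := intro x; positivity) :
          Continuous (fun s : ℝ => 2 * s / (1 + s ^ 2) ^ 2)).continuousOn
      exact hcont.comp (by fun_prop) fun s hs => hmem hε hs
    · filter_upwards [self_mem_nhdsWithin] with ε hε
      have hε : 0 < ε := hε
      refine ae_of_all _ fun s => ?_
      by_cases hs : s ∈ Set.Ioc (-(δ / ε)) (δ / ε)
      · rw [Set.indicator_of_mem hs, norm_mul, norm_div, norm_div, norm_mul]
        have h1 := hC _ (hmem hε hs)
        rw [add_sub_cancel_left, abs_mul, abs_of_pos hε] at h1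
        simp only [Real.norm_eq_abs]
        rw [abs_of_pos hε, abs_of_pos (by positivity : (0 : ℝ) < (1 + s ^ 2) ^ 2),
          abs_of_pos (by norm_num : (0 : ℝ) < 2), ← sq_abs s]
        have h2 : |Φ (x + ε * s)| / ε ≤ C * |s| := by
          rw [div_le_iff₀ hε]; linarith
        calc _ ≤ C * |s| * (2 * |s| / (1 + |s| ^ 2) ^ 2) := by gcongr
          _ = _ := by ring
      · rw [Set.indicator_of_notMem hs, norm_zero]; positivity
    · refine ae_of_all _ fun s => ?_
      have hslope : Tendsto (fun ε : ℝ => Φ (x + ε * s) / ε) (nhdsWithin 0 (Set.Ioi 0))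
          (nhds (c * s)) := by
        have h0 : HasDerivAt (fun ε : ℝ => Φ (x + ε * s)) (c * s) 0 := by
          have h1 : HasDerivAt (fun ε : ℝ => x + ε * s) s 0 := by
            simpa using ((hasDerivAt_id (0 : ℝ)).mul_const s).const_add x
          have h2 : HasDerivAt Φ c (x + 0 * s) := by simpa using hΦ
          exact h2.comp 0 h1
        have h3 := (hasDerivAt_iff_tendsto_slope_zero.mp h0).mono_left
          (nhdsWithin_mono 0 (fun y (hy : 0 < y) => (ne_of_gt hy : y ≠ 0)))
        refine h3.congr fun ε => ?_
        simp [hx, div_eq_inv_mul]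
      have h4 : Tendsto (fun ε : ℝ => Φ (x + ε * s) / ε * (2 * s / (1 + s ^ 2) ^ 2))
          (nhdsWithin 0 (Set.Ioi 0)) (nhds (c * (2 * s ^ 2 / (1 + s ^ 2) ^ 2))) := by
        convert! hslope.mul_const (2 * s / (1 + s ^ 2) ^ 2) using 2; ring
      refine h4.congr' ?_
      have hpos : 0 < δ / (|s| + 1) := by positivity
      filter_upwards [self_mem_nhdsWithin, mem_nhdsWithin_of_mem_nhds (Iio_mem_nhds hpos)]
        with ε hε hε2
      have hε : 0 < ε := hε
      have hε2 : ε < δ / (|s| + 1) := hε2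
      rw [lt_div_iff₀ (by positivity)] at hε2
      have : |s| < δ / ε := by rw [lt_div_iff₀ hε]; nlinarith
      rw [Set.indicator_of_mem]
      exact ⟨(abs_lt.mp this).1, (abs_lt.mp this).2.le⟩
  rw [integral_const_mul, integral_sq_div_sq, mul_comm] at hlim
  refine hlim.congr' ?_
  filter_upwards [self_mem_nhdsWithin] with ε hε
  exact (hsub ε hε).symm

/-- Fatou's theorem for the Poisson integral of the upper half-plane. -/
lemma ae_tendsto_poisson {ξ : ℝ → ℝ}
    (hint : Integrable (fun t : ℝ => ξ t / (t ^ 2 + 1))) :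
    ∀ᵐ x : ℝ, Tendsto (fun ε : ℝ => ∫ t, ξ t * (ε / ((t - x) ^ 2 + ε ^ 2)))
      (nhdsWithin 0 (Set.Ioi 0)) (nhds (Real.pi * ξ x)) := by
  have hloc := locallyIntegrable_of_integrable_div hint
  filter_upwards [_root_.LocallyIntegrable.ae_hasDerivAt_integral hloc] with x hx
  have hii : ∀ a b : ℝ, IntervalIntegrable ξ volume a b := fun a b =>
    intervalIntegrable_iff.mpr ((hloc.integrableOn_isCompact isCompact_uIcc).mono_set
      Set.uIoc_subset_uIcc)
  set Φ : ℝ → ℝ := fun y => ∫ t in x..y, ξ t with hΦdef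
  have hΦ : HasDerivAt Φ (ξ x) x := hx x
  have hΦ0 : Φ x = 0 := by simp [hΦdef]
  obtain ⟨δ, hδ, hC⟩ : ∃ δ > 0, ∀ y ∈ Set.Icc (x - δ) (x + δ),
      |Φ y| ≤ (|ξ x| + 1) * |y - x| := by
    have h1 := hΦ.isLittleO.def (show (0 : ℝ) < 1 by norm_num)
    obtain ⟨δ, hδ, h⟩ := Metric.eventually_nhds_iff_ball.mp h1
    refine ⟨δ / 2, by positivity, fun y hy => ?_⟩
    have h2 := h y (by
      rw [Metric.mem_ball, Real.dist_eq, abs_lt]; constructor <;> linarith [hy.1, hy.2])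
    rw [hΦ0, smul_eq_mul, Real.norm_eq_abs, Real.norm_eq_abs, sub_zero, one_mul] at h2
    have h3 : |Φ y| ≤ |Φ y - (y - x) * ξ x| + |(y - x) * ξ x| := by
      simpa using abs_add_le (Φ y - (y - x) * ξ x) ((y - x) * ξ x)
    rw [abs_mul] at h3
    nlinarith
  have hprim : IsPrimitiveOn Φ ξ (x - δ) (x + δ) :=
    ⟨hii _ _, fun y _ => (intervalIntegral.integral_add_adjacent_intervals (hii _ _)
      (hii _ _)).symm⟩
  have hle : x - δ ≤ x + δ := by linarith
  have hscal := tendsto_integral_scaled hδ hΦ hΦ0 (hprim.continuousOn hle) hC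
  have hker : ∀ ε : ℝ, 0 < ε → ∀ y : ℝ, HasDerivAt (fun y => ε / ((y - x) ^ 2 + ε ^ 2))
      (-(2 * ε * (y - x) / ((y - x) ^ 2 + ε ^ 2) ^ 2)) y := by
    intro ε hε y
    have h2 : HasDerivAt (fun y : ℝ => (y - x) ^ 2 + ε ^ 2) (2 * (y - x)) y := by
      simpa using (((hasDerivAt_id y).sub_const x).pow 2).add_const (ε ^ 2)
    have h3 := (hasDerivAt_const y ε).div h2 (by positivity)
    convert! h3 using 1
    field_simp
    ring
  have hkint : Tendsto (fun ε : ℝ => ε / (δ ^ 2 + ε ^ 2)) (nhdsWithin 0 (Set.Ioi 0))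
      (nhds 0) := by
    have : ContinuousAt (fun ε : ℝ => ε / (δ ^ 2 + ε ^ 2)) 0 := by
      refine ContinuousAt.div (by fun_prop) (by fun_prop) (by positivity)
    simpa using this.tendsto.mono_left nhdsWithin_le_nhds
  have hlocal : Tendsto (fun ε : ℝ => ∫ t in (x - δ)..(x + δ),
      ξ t * (ε / ((t - x) ^ 2 + ε ^ 2))) (nhdsWithin 0 (Set.Ioi 0))
      (nhds (Real.pi * ξ x)) := by
    have h1 := (hkint.const_mul (Φ (x + δ) - Φ (x - δ))).add hscal
    rw [mul_zero, zero_add] at h1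
    refine h1.congr' ?_
    filter_upwards [self_mem_nhdsWithin] with ε hε
    have hε : 0 < ε := hε
    have hck : Continuous (fun y : ℝ => -(2 * ε * (y - x) / ((y - x) ^ 2 + ε ^ 2) ^ 2)) := by
      fun_prop (disch := intro x; positivity)
    have hP : IsPrimitiveOn (fun y => ε / ((y - x) ^ 2 + ε ^ 2))
        (fun y => -(2 * ε * (y - x) / ((y - x) ^ 2 + ε ^ 2) ^ 2)) (x - δ) (x + δ) := by
      refine ⟨hck.intervalIntegrable _ _, fun y hy => ?_⟩
      rw [intervalIntegral.integral_eq_sub_of_hasDerivAt (fun z _ => hker ε hε z)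
        (hck.intervalIntegrable _ _)]
      ring
    have hibp := IsPrimitiveOn.integral_mul_real hle hprim hP
    have hc1 := hprim.continuousOn hle
    have hc2 := hP.continuousOn hle
    rw [← Set.uIcc_of_le hle] at hc1 hc2
    rw [intervalIntegral.integral_add ((hii _ _).mul_continuousOn hc2)
      (hP.1.continuousOn_mul hc1)] at hibp
    simp only [mul_neg, intervalIntegral.integral_neg] at hibp
    have e1 : (x + δ - x) ^ 2 = δ ^ 2 := by ring
    have e2 : (x - δ - x) ^ 2 = δ ^ 2 := by ring
    rw [e1, e2] at hibp
    linarith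
  have hkb : ∀ ε : ℝ, 0 < ε → ∀ t ∈ (Set.Ioc (x - δ) (x + δ))ᶜ,
      ‖ξ t * (ε / ((t - x) ^ 2 + ε ^ 2))‖ ≤
        ε * ((2 + (2 * x ^ 2 + 1) / δ ^ 2) * ‖ξ t / (t ^ 2 + 1)‖) := by
    intro ε hε t ht
    have hd : δ ^ 2 ≤ (t - x) ^ 2 := by
      rw [Set.mem_compl_iff, Set.mem_Ioc, not_and_or, not_lt, not_le] at ht
      rcases ht with h | h <;> nlinarith
    have hd0 : 0 < (t - x) ^ 2 := lt_of_lt_of_le (by positivity) hd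
    rw [norm_mul, norm_div, norm_div, Real.norm_of_nonneg hε.le,
      Real.norm_of_nonneg (by positivity : (0 : ℝ) ≤ (t - x) ^ 2 + ε ^ 2),
      Real.norm_of_nonneg (by positivity : (0 : ℝ) ≤ t ^ 2 + 1)]
    have h1 : t ^ 2 + 1 ≤ (2 + (2 * x ^ 2 + 1) / δ ^ 2) * ((t - x) ^ 2 + ε ^ 2) := by
      have h2 : 2 * x ^ 2 + 1 ≤ (2 * x ^ 2 + 1) / δ ^ 2 * (t - x) ^ 2 := by
        rw [div_mul_eq_mul_div, le_div_iff₀ (by positivity)]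
        exact mul_le_mul_of_nonneg_left hd (by positivity)
      have h3 : 0 ≤ (2 + (2 * x ^ 2 + 1) / δ ^ 2) * ε ^ 2 := by positivity
      nlinarith [sq_nonneg (t - 2 * x)]
    have h4 : ε / ((t - x) ^ 2 + ε ^ 2) ≤
        ε * ((2 + (2 * x ^ 2 + 1) / δ ^ 2) / (t ^ 2 + 1)) := by
      rw [div_le_iff₀ (by positivity), mul_assoc]
      refine le_mul_of_one_le_right hε.le ?_
      rw [div_mul_eq_mul_div, le_div_iff₀ (by positivity), one_mul]
      exact h1
    calc _ ≤ ‖ξ t‖ * (ε * ((2 + (2 * x ^ 2 + 1) / δ ^ 2) / (t ^ 2 + 1))) := by gcongr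
      _ = _ := by ring
  have hmeas : ∀ ε : ℝ, 0 < ε →
      AEStronglyMeasurable (fun t => ξ t * (ε / ((t - x) ^ 2 + ε ^ 2))) volume := by
    intro ε hε
    refine hloc.aestronglyMeasurable.mul (Continuous.aestronglyMeasurable ?_)
    fun_prop (disch := intro x; positivity)
  have hdom : Integrable (fun t => (2 + (2 * x ^ 2 + 1) / δ ^ 2) * ‖ξ t / (t ^ 2 + 1)‖) :=
    hint.norm.const_mul _
  have hfar : Tendsto (fun ε : ℝ => ∫ t in (Set.Ioc (x - δ) (x + δ))ᶜ,
      ξ t * (ε / ((t - x) ^ 2 + ε ^ 2))) (nhdsWithin 0 (Set.Ioi 0)) (nhds 0) := by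
    have h0 : Tendsto (fun ε : ℝ => ε * ∫ t in (Set.Ioc (x - δ) (x + δ))ᶜ,
        (2 + (2 * x ^ 2 + 1) / δ ^ 2) * ‖ξ t / (t ^ 2 + 1)‖)
        (nhdsWithin 0 (Set.Ioi 0)) (nhds 0) := by
      have : Tendsto (fun ε : ℝ => ε) (nhdsWithin (0 : ℝ) (Set.Ioi 0)) (nhds 0) :=
        tendsto_id.mono_left nhdsWithin_le_nhds
      simpa using this.mul_const _
    refine squeeze_zero_norm' ?_ h0
    filter_upwards [self_mem_nhdsWithin] with ε hε
    rw [← integral_const_mul]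
    refine norm_integral_le_of_norm_le (hdom.const_mul ε).integrableOn ?_
    exact (ae_restrict_iff' measurableSet_Ioc.compl).mpr (ae_of_all _ (hkb ε hε))
  have hsum := hlocal.add hfar
  rw [add_zero] at hsum
  refine hsum.congr' ?_
  filter_upwards [self_mem_nhdsWithin] with ε hε
  have hε : 0 < ε := hε
  have hck : Continuous (fun t : ℝ => ε / ((t - x) ^ 2 + ε ^ 2)) := by
    fun_prop (disch := intro x; positivity)
  have i1 : IntegrableOn (fun t => ξ t * (ε / ((t - x) ^ 2 + ε ^ 2)))
      (Set.Ioc (x - δ) (x + δ)) :=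
    (intervalIntegrable_iff_integrableOn_Ioc_of_le hle).mp
      ((hii _ _).mul_continuousOn hck.continuousOn)
  have i2 : IntegrableOn (fun t => ξ t * (ε / ((t - x) ^ 2 + ε ^ 2)))
      (Set.Ioc (x - δ) (x + δ))ᶜ :=
    Integrable.mono' (hdom.const_mul ε).integrableOn (hmeas ε hε).restrict
      ((ae_restrict_iff' measurableSet_Ioc.compl).mpr (ae_of_all _ (hkb ε hε)))
  rw [intervalIntegral.integral_of_le hle]
  have hall : Integrable (fun t => ξ t * (ε / ((t - x) ^ 2 + ε ^ 2))) := by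
    rw [← integrableOn_univ, ← Set.union_compl_self (Set.Ioc (x - δ) (x + δ))]
    exact i1.union i2
  exact integral_add_compl measurableSet_Ioc hall

/-! ### Nevanlinna-type integrals in the upper half-plane -/

/-- The Cauchy-type integral `∫ ξ(t) ((t - z)⁻¹ - t (t² + 1)⁻¹) dt`. -/
def nevanlinnaIntegral (ξ : ℝ → ℝ) (z : ℂ) : ℂ :=
  ∫ t : ℝ, ((ξ t / (t ^ 2 + 1) : ℝ) : ℂ) * ((1 + t * z) / (t - z))

lemma ofReal_sub_ne_zero_of_im_ne_zero {z : ℂ} (hz : z.im ≠ 0) (t : ℝ) : (t : ℂ) - z ≠ 0 := by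
  intro h
  apply hz
  have := congrArg Complex.im h
  simpa using this

lemma abs_im_le_norm_ofReal_sub (z : ℂ) (t : ℝ) : |z.im| ≤ ‖(t : ℂ) - z‖ := by
  have := Complex.abs_im_le_norm ((t : ℂ) - z)
  simpa using this

lemma sq_add_one_le_norm_ofReal_sub_sq {z : ℂ} {η M : ℝ} (hη : 0 < η) (h1 : η ≤ |z.im|)
    (h2 : ‖z‖ ≤ M) (t : ℝ) :
    t ^ 2 + 1 ≤ (2 + (2 * M ^ 2 + 1) / η ^ 2) * ‖(t : ℂ) - z‖ ^ 2 := by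
  have h3 : η ^ 2 ≤ ‖(t : ℂ) - z‖ ^ 2 :=
    pow_le_pow_left₀ hη.le (h1.trans (abs_im_le_norm_ofReal_sub z t)) 2
  have h4 : |t| ≤ ‖(t : ℂ) - z‖ + M := by
    have := norm_add_le ((t : ℂ) - z) z
    rw [sub_add_cancel, Complex.norm_real, Real.norm_eq_abs] at this
    linarith
  have h5 : 2 * M ^ 2 + 1 ≤ (2 * M ^ 2 + 1) / η ^ 2 * ‖(t : ℂ) - z‖ ^ 2 := by
    rw [div_mul_eq_mul_div, le_div_iff₀ (by positivity)]
    exact mul_le_mul_of_nonneg_left h3 (by positivity)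
  have h6 : t ^ 2 ≤ (‖(t : ℂ) - z‖ + M) ^ 2 := by
    rw [← sq_abs t]; exact pow_le_pow_left₀ (abs_nonneg t) h4 2
  nlinarith [sq_nonneg (‖(t : ℂ) - z‖ - M)]

lemma integrable_nevanlinna {ξ : ℝ → ℝ} (hint : Integrable (fun t : ℝ => ξ t / (t ^ 2 + 1)))
    {z : ℂ} (hz : z.im ≠ 0) :
    Integrable (fun t : ℝ => ((ξ t / (t ^ 2 + 1) : ℝ) : ℂ) * ((1 + t * z) / (t - z))) := by
  have hz' : 0 < |z.im| := abs_pos.mpr hz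
  refine hint.ofReal.mul_bdd (c := ‖1 + z ^ 2‖ / |z.im| + ‖z‖) ?_ (ae_of_all _ fun t => ?_)
  · refine Continuous.aestronglyMeasurable ?_
    refine Continuous.div (by fun_prop) (by fun_prop) (ofReal_sub_ne_zero_of_im_ne_zero hz)
  · have hne := ofReal_sub_ne_zero_of_im_ne_zero hz t
    have e : (1 + t * z) / (t - z) = (1 + z ^ 2) / (t - z) + z := by field_simp; ring
    rw [e]
    refine (norm_add_le _ _).trans ?_
    rw [norm_div]
    gcongr
    exact abs_im_le_norm_ofReal_sub z t

lemma hasDerivAt_nevanlinnaIntegral {ξ : ℝ → ℝ}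
    (hint : Integrable (fun t : ℝ => ξ t / (t ^ 2 + 1))) {z : ℂ} (hz : z.im ≠ 0) :
    HasDerivAt (nevanlinnaIntegral ξ) (∫ t : ℝ, (ξ t : ℂ) / (t - z) ^ 2) z := by
  have hz' : 0 < |z.im| := abs_pos.mpr hz
  set η := |z.im| / 2 with hη
  have hη0 : 0 < η := by positivity
  have him : ∀ w ∈ Metric.ball z η, η ≤ |w.im| := by
    intro w hw
    rw [Metric.mem_ball, dist_eq_norm] at hw
    have h1 := Complex.abs_im_le_norm (w - z)
    rw [Complex.sub_im] at h1
    have h2 := abs_sub_abs_le_abs_sub z.im w.im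
    rw [abs_sub_comm] at h2
    linarith
  have hnorm : ∀ w ∈ Metric.ball z η, ‖w‖ ≤ ‖z‖ + η := by
    intro w hw
    rw [Metric.mem_ball, dist_eq_norm] at hw
    have := norm_sub_norm_le w z
    linarith
  have hne : ∀ w ∈ Metric.ball z η, w.im ≠ 0 := fun w hw =>
    abs_pos.mp (hη0.trans_le (him w hw))
  have hmeasF : ∀ w ∈ Metric.ball z η, AEStronglyMeasurable
      (fun t : ℝ => ((ξ t / (t ^ 2 + 1) : ℝ) : ℂ) * ((1 + t * w) / (t - w))) volume :=
    fun w hw => (integrable_nevanlinna hint (hne w hw)).aestronglyMeasurable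
  have hder : ∀ w ∈ Metric.ball z η, ∀ t : ℝ, HasDerivAt
      (fun w : ℂ => ((ξ t / (t ^ 2 + 1) : ℝ) : ℂ) * ((1 + t * w) / (t - w)))
      ((ξ t : ℂ) / (t - w) ^ 2) w := by
    intro w hw t
    have hw0 := ofReal_sub_ne_zero_of_im_ne_zero (hne w hw) t
    have ht : ((t : ℂ) ^ 2 + 1) ≠ 0 := by
      have : (0 : ℝ) < t ^ 2 + 1 := by positivity
      exact_mod_cast this.ne'
    have h1 : HasDerivAt (fun w : ℂ => 1 + t * w) (t : ℂ) w := by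
      simpa using ((hasDerivAt_id w).const_mul (t : ℂ)).const_add 1
    have h2 : HasDerivAt (fun w : ℂ => (t : ℂ) - w) (-1) w := by
      simpa using (hasDerivAt_id w).const_sub (t : ℂ)
    convert! (h1.div h2 hw0).const_mul ((ξ t / (t ^ 2 + 1) : ℝ) : ℂ) using 1
    push_cast
    field_simp
    ring
  have hbound : ∀ w ∈ Metric.ball z η, ∀ t : ℝ, ‖(ξ t : ℂ) / (t - w) ^ 2‖ ≤
      (2 + (2 * (‖z‖ + η) ^ 2 + 1) / η ^ 2) * ‖ξ t / (t ^ 2 + 1)‖ := by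
    intro w hw t
    have h1 := sq_add_one_le_norm_ofReal_sub_sq hη0 (him w hw) (hnorm w hw) t
    have h0 : 0 < ‖(t : ℂ) - w‖ :=
      norm_pos_iff.mpr (ofReal_sub_ne_zero_of_im_ne_zero (hne w hw) t)
    rw [norm_div, norm_div, norm_pow, Complex.norm_real,
      Real.norm_of_nonneg (by positivity : (0 : ℝ) ≤ t ^ 2 + 1), div_le_iff₀ (by positivity),
      mul_div_assoc', div_mul_eq_mul_div, le_div_iff₀ (by positivity)]
    have := mul_le_mul_of_nonneg_left h1 (norm_nonneg (ξ t))
    linarith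
  have hmeas' : AEStronglyMeasurable (fun t : ℝ => (ξ t : ℂ) / (t - z) ^ 2) volume := by
    simp_rw [div_eq_mul_inv]
    refine AEStronglyMeasurable.mul ?_ (Continuous.aestronglyMeasurable ?_)
    · exact Complex.continuous_ofReal.comp_aestronglyMeasurable
        (locallyIntegrable_of_integrable_div hint).aestronglyMeasurable
    · refine Continuous.inv₀ (by fun_prop) fun t => ?_
      exact pow_ne_zero 2 (ofReal_sub_ne_zero_of_im_ne_zero hz t)
  exact (hasDerivAt_integral_of_dominated_loc_of_deriv_le (Metric.ball_mem_nhds z hη0)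
    (eventually_of_mem (Metric.ball_mem_nhds z hη0) hmeasF)
    (integrable_nevanlinna hint hz) hmeas'
    (ae_of_all _ fun t w hw => hbound w hw t) (hint.norm.const_mul _)
    (ae_of_all _ fun t w hw => hder w hw t)).2

lemma im_nevanlinnaIntegral {ξ : ℝ → ℝ}
    (hint : Integrable (fun t : ℝ => ξ t / (t ^ 2 + 1))) (x : ℝ) {ε : ℝ} (hε : ε ≠ 0) :
    (nevanlinnaIntegral ξ (x + ε * Complex.I)).im =
      ∫ t, ξ t * (ε / ((t - x) ^ 2 + ε ^ 2)) := by
  have hz : (x + ε * Complex.I : ℂ).im ≠ 0 := by simpa using hε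
  have h := Complex.imCLM.integral_comp_comm (integrable_nevanlinna hint hz)
  simp only [Complex.imCLM_apply] at h
  rw [nevanlinnaIntegral, ← h]
  refine integral_congr_ae (ae_of_all _ fun t => ?_)
  have ht : t ^ 2 + 1 ≠ 0 := by positivity
  have hd : (t - x) ^ 2 + ε ^ 2 ≠ 0 := by positivity
  have hn : Complex.normSq ((t : ℂ) - (x + ε * Complex.I)) = (t - x) ^ 2 + ε ^ 2 := by
    simp [Complex.normSq_apply]; ring
  simp only [Complex.im_ofReal_mul, Complex.div_im, hn]
  simp
  field_simp
  ring

lemma isOpen_offCut (c : ℝ) : IsOpen (offCut c) := by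
  have : offCut c = {z : ℂ | z.im ≠ 0} ∪ {z : ℂ | z.re < c} := by ext; rfl
  rw [this]
  exact (isOpen_ne_fun Complex.continuous_im continuous_const).union
    (isOpen_lt Complex.continuous_re continuous_const)

/-- Recovery of `ξ` from a function on `ℂ \ [c, ∞)` that is real below `c` and whose derivative
is the Stieltjes-type integral of `ξ`. -/
lemma ae_tendsto_im_of_deriv_eq {ξ : ℝ → ℝ} {c : ℝ} {L : ℂ → ℂ}
    (hint : Integrable (fun t : ℝ => ξ t / (t ^ 2 + 1)))
    (hξ : ∀ t < c, ξ t = 0) (hL : DifferentiableOn ℂ L (offCut c))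
    (hreal : ∀ x : ℝ, x < c → (L x).im = 0)
    (hder : ∀ z : ℂ, 0 < z.im →
      deriv L z = ∫ t in Set.Ici c, (ξ t : ℂ) / ((t : ℂ) - z) ^ 2) :
    ∀ᵐ x : ℝ, Tendsto (fun ε : ℝ => Real.pi⁻¹ * (L (x + ε * Complex.I)).im)
      (nhdsWithin 0 (Set.Ioi 0)) (nhds (ξ x)) := by
  have hopen := isOpen_offCut c
  have hU : IsOpen {z : ℂ | 0 < z.im} := isOpen_lt continuous_const Complex.continuous_im
  have hUc : IsPreconnected {z : ℂ | 0 < z.im} := (convex_halfSpace_im_gt 0).isPreconnected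
  have hset : ∀ z : ℂ, ∫ t in Set.Ici c, (ξ t : ℂ) / ((t : ℂ) - z) ^ 2 =
      ∫ t : ℝ, (ξ t : ℂ) / ((t : ℂ) - z) ^ 2 := by
    intro z
    refine setIntegral_eq_integral_of_forall_compl_eq_zero fun t ht => ?_
    rw [Set.mem_Ici, not_le] at ht
    simp [hξ t ht]
  have hLd : ∀ z : ℂ, 0 < z.im → DifferentiableAt ℂ L z := fun z hz =>
    hL.differentiableAt (hopen.mem_nhds (Or.inl hz.ne'))
  obtain ⟨C, hC⟩ : ∃ C, ∀ z : ℂ, 0 < z.im → L z = nevanlinnaIntegral ξ z + C := by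
    have hd : DifferentiableOn ℂ (fun z => L z - nevanlinnaIntegral ξ z) {z : ℂ | 0 < z.im} :=
      fun z hz => ((hLd z hz).sub
        (hasDerivAt_nevanlinnaIntegral hint (ne_of_gt hz)).differentiableAt).differentiableWithinAt
    have h0 : Set.EqOn (deriv (fun z => L z - nevanlinnaIntegral ξ z)) 0 {z : ℂ | 0 < z.im} := by
      intro z hz
      have h1 := hasDerivAt_nevanlinnaIntegral hint (ne_of_gt hz)
      have h2 := ((hLd z hz).hasDerivAt.sub h1).deriv
      rw [hder z hz, hset, sub_self] at h2
      exact h2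
    obtain ⟨C, hC⟩ := hU.exists_is_const_of_deriv_eq_zero hUc hd h0
    exact ⟨C, fun z hz => by rw [← hC z hz]; ring⟩
  have hP := ae_tendsto_poisson hint
  have hIm : ∀ x : ℝ, Tendsto (fun ε : ℝ => ∫ t, ξ t * (ε / ((t - x) ^ 2 + ε ^ 2)))
      (nhdsWithin 0 (Set.Ioi 0)) (nhds (Real.pi * ξ x)) →
      Tendsto (fun ε : ℝ => (L (x + ε * Complex.I)).im)
      (nhdsWithin 0 (Set.Ioi 0)) (nhds (Real.pi * ξ x + C.im)) := by
    intro x hx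
    refine (hx.add_const C.im).congr' ?_
    filter_upwards [self_mem_nhdsWithin] with ε hε
    have hε : 0 < ε := hε
    rw [hC _ (by simpa using hε), Complex.add_im, im_nevanlinnaIntegral hint x hε.ne']
  have hC0 : C.im = 0 := by
    obtain ⟨x, hx, hxc⟩ : ∃ x, Tendsto (fun ε : ℝ => ∫ t, ξ t * (ε / ((t - x) ^ 2 + ε ^ 2)))
      (nhdsWithin 0 (Set.Ioi 0)) (nhds (Real.pi * ξ x)) ∧ x ∈ Set.Iio c := by
      have : (volume.restrict (Set.Iio c)) ≠ 0 := by
        rw [Ne, Measure.restrict_eq_zero]; simp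
      have : NeZero (volume.restrict (Set.Iio c)) := ⟨this⟩
      exact ((ae_restrict_of_ae hP).and (ae_restrict_mem measurableSet_Iio)).exists
    have h1 := hIm x hx
    rw [hξ x hxc, mul_zero, zero_add] at h1
    have hcont : ContinuousAt (fun ε : ℝ => (L (x + ε * Complex.I)).im) 0 := by
      have : ContinuousAt L ((x : ℂ) + (0 : ℝ) * Complex.I) := by
        refine (hL.differentiableAt (hopen.mem_nhds (Or.inr ?_))).continuousAt
        simpa using hxc
      exact Complex.continuous_im.continuousAt.comp
        (ContinuousAt.comp (f := fun ε : ℝ => (x : ℂ) + ε * Complex.I) this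
          (by fun_prop))
    have h2 := hcont.tendsto.mono_left (nhdsWithin_le_nhds (s := Set.Ioi (0 : ℝ)))
    have h3 := tendsto_nhds_unique h1 h2
    rw [h3]
    simpa using hreal x hxc
  filter_upwards [hP] with x hx
  have h1 := (hIm x hx).const_mul Real.pi⁻¹
  rw [hC0, add_zero, inv_mul_cancel_left₀ Real.pi_ne_zero] at h1
  exact h1

/-! ### Resolvents of self-adjoint operators -/

section Resolvent

variable {E : Type*} [NormedAddCommGroup E] [InnerProductSpace ℂ E]

lemma isResolvent_res {A : E →ₗ.[ℂ] E} {z : ℂ} (hz : z ∈ resolventSetP A) :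
    IsResolvent A z (res A z) := by
  have hz : ∃ T, IsResolvent A z T := hz
  rw [res, dif_pos hz]
  exact hz.choose_spec

lemma res_mem_graph {A : E →ₗ.[ℂ] E} {z : ℂ} (hz : z ∈ resolventSetP A) (h : E) :
    (res A z h, h + z • res A z h) ∈ A.graph := by
  obtain ⟨hx, he⟩ := (isResolvent_res hz).1 h
  rw [LinearPMap.mem_graph_iff]
  exact ⟨⟨_, hx⟩, rfl, by rw [← sub_eq_iff_eq_add]; exact he⟩

lemma eq_zero_of_mem_graph_smul {A : E →ₗ.[ℂ] E} {z : ℂ} (hz : z ∈ resolventSetP A) {u : E}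
    (hu : (u, z • u) ∈ A.graph) : u = 0 := by
  rw [LinearPMap.mem_graph_iff] at hu
  obtain ⟨y, hy, hAy⟩ := hu
  have := (isResolvent_res hz).2 y
  simp only at hy hAy
  rw [hAy, hy, sub_self, map_zero] at this
  exact this.symm

lemma abs_im_mul_norm_le [CompleteSpace E] {A : E →ₗ.[ℂ] E} (hA : IsSelfAdjoint A) (z : ℂ)
    (x : A.domain) : |z.im| * ‖(x : E)‖ ≤ ‖A x - z • (x : E)‖ := by
  have hsymm : ⟪A x, (x : E)⟫_ℂ = ⟪(x : E), A x⟫_ℂ := by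
    have h := LinearPMap.adjoint_isFormalAdjoint hA.dense_domain
    rw [LinearPMap.isSelfAdjoint_def.mp hA] at h
    exact h x x
  have him : (⟪(x : E), A x⟫_ℂ).im = 0 := by
    rw [← Complex.conj_eq_iff_im, inner_conj_symm, hsymm]
  have h1 : (⟪(x : E), A x - z • (x : E)⟫_ℂ).im = -(z.im * ‖(x : E)‖ ^ 2) := by
    rw [inner_sub_right, inner_smul_right, Complex.sub_im, him, inner_self_eq_norm_sq_to_K]
    simp [← Complex.ofReal_pow]
  have h2 := (Complex.abs_im_le_norm _).trans (norm_inner_le_norm (𝕜 := ℂ) (x : E)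
    (A x - z • (x : E)))
  rw [h1, abs_neg, abs_mul, abs_of_nonneg (by positivity : (0 : ℝ) ≤ ‖(x : E)‖ ^ 2)] at h2
  rcases (norm_nonneg (x : E)).eq_or_lt with h0 | h0
  · rw [← h0, mul_zero]; exact norm_nonneg _
  · refine le_of_mul_le_mul_left ?_ h0
    linarith

/-- Nonreal numbers belong to the resolvent set of a self-adjoint operator. -/
lemma mem_resolventSetP_of_isSelfAdjoint [CompleteSpace E] {A : E →ₗ.[ℂ] E}
    (hA : IsSelfAdjoint A) {z : ℂ} (hz : z.im ≠ 0) : z ∈ resolventSetP A := by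
  have hz' : 0 < |z.im| := abs_pos.mpr hz
  have hcl : IsClosed (A.graph : Set (E × E)) := hA.isClosed
  have : CompleteSpace A.graph := hcl.completeSpace_coe
  let f : A.graph →L[ℂ] E :=
    (ContinuousLinearMap.snd ℂ E E - z • ContinuousLinearMap.fst ℂ E E).comp A.graph.subtypeL
  have hf : ∀ p : A.graph, f p = (p : E × E).2 - z • (p : E × E).1 := fun p => rfl
  have hgraph : ∀ p : A.graph, ∃ y : A.domain, (y : E) = (p : E × E).1 ∧ A y = (p : E × E).2 :=
    fun p => (LinearPMap.mem_graph_iff A).mp p.2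
  have hlow : ∀ p : A.graph, |z.im| * ‖(p : E × E).1‖ ≤ ‖f p‖ := by
    intro p
    obtain ⟨y, hy1, hy2⟩ := hgraph p
    rw [hf, ← hy1, ← hy2]
    exact abs_im_mul_norm_le hA z y
  have hanti : AntilipschitzWith (Real.toNNReal (1 + (1 + ‖z‖) / |z.im|)) f := by
    refine ContinuousLinearMap.antilipschitz_of_bound f fun p => ?_
    rw [Real.coe_toNNReal _ (by positivity)]
    have h1 : ‖(p : E × E).1‖ ≤ ‖f p‖ / |z.im| := by
      rw [le_div_iff₀ hz', mul_comm]; exact hlow p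
    have h2 : ‖(p : E × E).2‖ ≤ ‖f p‖ + ‖z‖ * (‖f p‖ / |z.im|) := by
      have : (p : E × E).2 = f p + z • (p : E × E).1 := by rw [hf]; abel
      rw [this]
      refine (norm_add_le _ _).trans ?_
      rw [norm_smul]
      gcongr
    have h3 : 0 ≤ ‖f p‖ / |z.im| := by positivity
    have h4 : (1 + (1 + ‖z‖) / |z.im|) * ‖f p‖ =
        ‖f p‖ + ‖f p‖ / |z.im| + ‖z‖ * (‖f p‖ / |z.im|) := by ring
    rw [h4]
    have h5 : 0 ≤ ‖z‖ * (‖f p‖ / |z.im|) := by positivity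
    have h6 : ‖p‖ = max ‖(p : E × E).1‖ ‖(p : E × E).2‖ := rfl
    rw [h6]
    refine max_le ?_ ?_ <;> linarith [norm_nonneg (f p)]
  have hclosed : IsClosed (f.range : Set E) := by
    have := hanti.isClosed_range f.uniformContinuous
    rwa [LinearMap.coe_range]
  have hrange : f.range = ⊤ := by
    have : CompleteSpace f.range := hclosed.completeSpace_coe
    rw [← Submodule.orthogonal_eq_bot_iff, Submodule.eq_bot_iff]
    intro v hv
    rw [Submodule.mem_orthogonal'] at hv
    have hv' : ∀ x : A.domain,
        ⟪(starRingEnd ℂ z) • v, (x : E)⟫_ℂ = ⟪v, A x⟫_ℂ := by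
      intro x
      have h := hv _ ⟨⟨((x : E), A x), LinearPMap.mem_graph A x⟩, rfl⟩
      change ⟪v, A x - z • (x : E)⟫_ℂ = 0 at h
      rw [inner_sub_right, inner_smul_right, sub_eq_zero] at h
      rw [inner_smul_left, Complex.conj_conj, h]
    have hmem : (v, (starRingEnd ℂ z) • v) ∈ A.adjoint.graph := by
      have hd : v ∈ A.adjoint.domain :=
        LinearPMap.mem_adjoint_domain_of_exists v ⟨_, hv'⟩
      rw [LinearPMap.mem_graph_iff]
      exact ⟨⟨v, hd⟩, rfl, LinearPMap.adjoint_apply_eq hA.dense_domain ⟨v, hd⟩ hv'⟩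
    rw [LinearPMap.isSelfAdjoint_def.mp hA, LinearPMap.mem_graph_iff] at hmem
    obtain ⟨y, hy1, hy2⟩ := hmem
    have h := abs_im_mul_norm_le hA (starRingEnd ℂ z) y
    simp only at hy1 hy2
    rw [hy2, hy1, sub_self, norm_zero, Complex.conj_im, abs_neg] at h
    exact norm_le_zero_iff.mp (nonpos_of_mul_nonpos_right h hz')
  let e := ContinuousLinearEquiv.ofBijective f
    (LinearMap.ker_eq_bot.mpr hanti.injective) hrange
  refine ⟨(ContinuousLinearMap.fst ℂ E E).comp
    (A.graph.subtypeL.comp (e.symm : E →L[ℂ] A.graph)), fun x => ?_, fun u => ?_⟩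
  · obtain ⟨y, hy1, hy2⟩ := hgraph (e.symm x)
    have h1 : f (e.symm x) = x := e.apply_symm_apply x
    change ∃ hx : ((e.symm x : A.graph) : E × E).1 ∈ A.domain, _
    refine ⟨hy1 ▸ y.2, ?_⟩
    have : (⟨((e.symm x : A.graph) : E × E).1, hy1 ▸ y.2⟩ : A.domain) = y :=
      Subtype.ext hy1.symm
    rw [hf] at h1
    change A ⟨((e.symm x : A.graph) : E × E).1, _⟩ - z • ((e.symm x : A.graph) : E × E).1 = x
    rw [this, hy2]
    exact h1
  · have h1 : e ⟨((u : E), A u), LinearPMap.mem_graph A u⟩ = A u - z • (u : E) := rfl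
    change ((e.symm (A u - z • (u : E)) : A.graph) : E × E).1 = u
    rw [← h1, e.symm_apply_apply]

end Resolvent

/-! ### Volterra operators and fundamental solutions -/

namespace IsPrimitiveOn

lemma pow {F f : ℝ → ℝ} {a b : ℝ} (hab : a ≤ b) (hF : IsPrimitiveOn F f a b) (n : ℕ) :
    IsPrimitiveOn (fun x => F x ^ (n + 1)) (fun x => (n + 1) * (F x ^ n * f x)) a b := by
  induction n with
  | zero => simpa using hF
  | succ n ih =>
    have hc : ContinuousOn F (Set.uIcc a b) := by
      rw [Set.uIcc_of_le hab]; exact hF.continuousOn hab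
    refine ⟨(hF.1.continuousOn_mul (hc.pow (n + 1))).const_mul _, fun x hx => ?_⟩
    have h := integral_mul_real hx.1 (ih.mono hx.1 hx.2) (hF.mono hx.1 hx.2)
    have e : ∀ t, (n + 1) * (F t ^ n * f t) * F t + F t ^ (n + 1) * f t =
        ((n + 1 : ℕ) + 1) * (F t ^ (n + 1) * f t) := by
      intro t; push_cast; ring
    simp only [e] at h
    rw [h]
    ring

end IsPrimitiveOn

lemma isUnit_one_sub_of_norm_pow_lt_one {A : Type*} [NormedRing A] [HasSummableGeomSeries A]
    {a : A} {n : ℕ} (h : ‖a ^ n‖ < 1) : IsUnit (1 - a) := by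
  have hu := isUnit_one_sub_of_norm_lt_one h
  rw [← mul_neg_geom_sum] at hu
  have hcomm : Commute (1 - a) a := (Commute.one_left a).sub_left (Commute.refl a)
  exact ((Commute.sum_right _ _ _ fun i _ => hcomm.pow_right i).isUnit_mul_iff.mp hu).1

lemma continuousAt_ringInverse_comp {A X : Type*} [NormedRing A] [HasSummableGeomSeries A]
    [TopologicalSpace X] {f : X → A} {x : X} (hf : ContinuousAt f x) (h : IsUnit (f x)) :
    ContinuousAt (fun y => Ring.inverse (f y)) x := by
  obtain ⟨w, hw⟩ := h
  have h1 := NormedRing.inverse_continuousAt w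
  rw [hw] at h1
  exact ContinuousAt.comp (f := f) h1 hf

lemma continuous_one_sub_sub_smul {E : Type*} [NormedAddCommGroup E] [NormedSpace ℂ E]
    (A B : E →L[ℂ] E) : Continuous fun z : ℂ => 1 - (A - z • B) := by
  fun_prop

section Volterra

variable {R : ℝ} (hR : 0 ≤ R)

/-- The double primitive `x ↦ ∫₀ˣ ∫₀ˢ q u`. -/
def volterraFun (q : ℝ → ℂ) (u : C(Set.Icc (0 : ℝ) R, ℂ)) (x : ℝ) : ℂ :=
  ∫ s in (0 : ℝ)..x, ∫ t in (0 : ℝ)..s, q t * Set.IccExtend hR u t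

lemma intervalIntegrable_mul_IccExtend {q : ℝ → ℂ} (hq : IntervalIntegrable q volume 0 R)
    (u : C(Set.Icc (0 : ℝ) R, ℂ)) {x : ℝ} (hx : x ∈ Set.Icc 0 R) :
    IntervalIntegrable (fun t => q t * Set.IccExtend hR u t) volume 0 x := by
  have h : IntervalIntegrable (fun t => q t * Set.IccExtend hR u t) volume 0 R :=
    hq.mul_continuousOn u.continuous.Icc_extend'.continuousOn
  refine h.mono_set ?_
  rw [Set.uIcc_of_le hx.1, Set.uIcc_of_le hR]
  exact Set.Icc_subset_Icc_right hx.2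

lemma continuousOn_integral_mul_IccExtend {q : ℝ → ℂ} (hq : IntervalIntegrable q volume 0 R)
    (u : C(Set.Icc (0 : ℝ) R, ℂ)) :
    ContinuousOn (fun s => ∫ t in (0 : ℝ)..s, q t * Set.IccExtend hR u t) (Set.Icc 0 R) := by
  have h := intervalIntegral.continuousOn_primitive_interval'
    (intervalIntegrable_mul_IccExtend hR hq u ⟨hR, le_rfl⟩) Set.left_mem_uIcc
  rwa [Set.uIcc_of_le hR] at h

lemma intervalIntegrable_integral_mul_IccExtend {q : ℝ → ℂ}
    (hq : IntervalIntegrable q volume 0 R) (u : C(Set.Icc (0 : ℝ) R, ℂ)) {x : ℝ}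
    (hx : x ∈ Set.Icc 0 R) :
    IntervalIntegrable (fun s => ∫ t in (0 : ℝ)..s, q t * Set.IccExtend hR u t) volume 0 x := by
  refine ContinuousOn.intervalIntegrable ?_
  rw [Set.uIcc_of_le hx.1]
  exact (continuousOn_integral_mul_IccExtend hR hq u).mono (Set.Icc_subset_Icc_right hx.2)

lemma continuousOn_volterraFun {q : ℝ → ℂ} (hq : IntervalIntegrable q volume 0 R)
    (u : C(Set.Icc (0 : ℝ) R, ℂ)) : ContinuousOn (volterraFun hR q u) (Set.Icc 0 R) := by
  have h := intervalIntegral.continuousOn_primitive_interval'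
    (intervalIntegrable_integral_mul_IccExtend hR hq u ⟨hR, le_rfl⟩) Set.left_mem_uIcc
  rwa [Set.uIcc_of_le hR] at h

lemma norm_volterraFun_le {q : ℝ → ℂ} (hq : IntervalIntegrable q volume 0 R)
    (u : C(Set.Icc (0 : ℝ) R, ℂ)) {c : ℝ} (n : ℕ)
    (hu : ∀ x : Set.Icc (0 : ℝ) R, ‖u x‖ ≤ c * (∫ t in (0 : ℝ)..x, ‖q t‖) ^ n)
    (hc : 0 ≤ c) {x : ℝ} (hx : x ∈ Set.Icc 0 R) :
    ‖volterraFun hR q u x‖ ≤ R * c / (n + 1) * (∫ t in (0 : ℝ)..x, ‖q t‖) ^ (n + 1) := by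
  set m : ℝ → ℝ := fun x => ∫ t in (0 : ℝ)..x, ‖q t‖ with hm
  have hprim : IsPrimitiveOn m (fun t => ‖q t‖) 0 R :=
    ⟨hq.norm, fun x _ => by simp [hm]⟩
  have hmc : ContinuousOn m (Set.Icc 0 R) := hprim.continuousOn hR
  have hinner : ∀ s ∈ Set.Icc 0 R, ‖∫ t in (0 : ℝ)..s, q t * Set.IccExtend hR u t‖ ≤
      c / (n + 1) * m s ^ (n + 1) := by
    intro s hs
    have hsub : Set.uIcc 0 s ⊆ Set.Icc 0 R := by
      rw [Set.uIcc_of_le hs.1]; exact Set.Icc_subset_Icc_right hs.2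
    have hint := (hprim.mono hs.1 hs.2).1.continuousOn_mul ((hmc.mono hsub).pow n)
    have h1 : ‖∫ t in (0 : ℝ)..s, q t * Set.IccExtend hR u t‖ ≤
        ∫ t in (0 : ℝ)..s, c * (m t ^ n * ‖q t‖) := by
      refine intervalIntegral.norm_integral_le_of_norm_le hs.1 (ae_of_all _ fun t ht => ?_)
        (hint.const_mul c)
      have ht' : t ∈ Set.Icc 0 R := ⟨ht.1.le, ht.2.trans hs.2⟩
      rw [norm_mul, Set.IccExtend_of_mem hR _ ht', mul_comm]
      calc _ ≤ c * m t ^ n * ‖q t‖ := by gcongr; exact hu ⟨t, ht'⟩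
        _ = _ := by ring
    have h2 := (hprim.pow hR n).2 s hs
    simp only at h2
    rw [intervalIntegral.integral_const_mul] at h1 h2
    have h3 : m 0 = 0 := by simp [hm]
    rw [h3, zero_pow n.succ_ne_zero, zero_add] at h2
    refine h1.trans (le_of_eq ?_)
    rw [h2]
    field_simp
  have hmono : ∀ s ∈ Set.Icc 0 x, m s ≤ m x := by
    intro s hs
    refine intervalIntegral.integral_mono_interval le_rfl hs.1 hs.2
      (ae_of_all _ fun t => norm_nonneg _) (hprim.mono hx.1 hx.2).1
  have hm0 : ∀ s, 0 ≤ s → 0 ≤ m s := fun s hs =>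
    intervalIntegral.integral_nonneg hs fun t _ => norm_nonneg _
  have h := intervalIntegral.norm_integral_le_of_norm_le_const (a := 0) (b := x)
    (f := fun s => ∫ t in (0 : ℝ)..s, q t * Set.IccExtend hR u t)
    (C := c / (n + 1) * m x ^ (n + 1)) (fun s hs => by
      rw [Set.uIoc_of_le hx.1] at hs
      refine (hinner s ⟨hs.1.le, hs.2.trans hx.2⟩).trans ?_
      gcongr
      · exact hm0 s hs.1.le
      · exact hmono s ⟨hs.1.le, hs.2⟩)
  refine h.trans ?_
  rw [sub_zero, abs_of_nonneg hx.1]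
  calc c / (n + 1) * m x ^ (n + 1) * x ≤ c / (n + 1) * m x ^ (n + 1) * R := by
        have := hm0 x hx.1
        gcongr
        exact hx.2
    _ = _ := by ring

/-- The Volterra operator `u ↦ ∫₀ˣ ∫₀ˢ q u` on `C([0, R])`. -/
def volterraCLM {q : ℝ → ℂ} (hq : IntervalIntegrable q volume 0 R) :
    C(Set.Icc (0 : ℝ) R, ℂ) →L[ℂ] C(Set.Icc (0 : ℝ) R, ℂ) :=
  LinearMap.mkContinuous
    { toFun := fun u => ⟨_, (continuousOn_volterraFun hR hq u).domRestrict⟩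
      map_add' := fun u v => by
        ext x
        change volterraFun hR q (u + v) x = volterraFun hR q u x + volterraFun hR q v x
        unfold volterraFun
        rw [← intervalIntegral.integral_add
          (intervalIntegrable_integral_mul_IccExtend hR hq u x.2)
          (intervalIntegrable_integral_mul_IccExtend hR hq v x.2)]
        refine intervalIntegral.integral_congr fun s hs => ?_
        rw [Set.uIcc_of_le x.2.1] at hs
        have hs' : s ∈ Set.Icc 0 R := ⟨hs.1, hs.2.trans x.2.2⟩
        rw [← intervalIntegral.integral_add (intervalIntegrable_mul_IccExtend hR hq u hs')
          (intervalIntegrable_mul_IccExtend hR hq v hs')]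
        congr 1; funext t
        simp [Set.IccExtend, mul_add]
      map_smul' := fun c u => by
        ext x
        change volterraFun hR q (c • u) x = c * volterraFun hR q u x
        unfold volterraFun
        rw [← intervalIntegral.integral_const_mul]
        congr 1; funext s
        rw [← intervalIntegral.integral_const_mul]
        congr 1; funext t
        simp [Set.IccExtend, mul_left_comm] }
    (R * ∫ t in (0 : ℝ)..R, ‖q t‖) fun u => by
      have h0 : 0 ≤ R * ∫ t in (0 : ℝ)..R, ‖q t‖ :=
        mul_nonneg hR (intervalIntegral.integral_nonneg hR fun t _ => norm_nonneg _)
      refine (ContinuousMap.norm_le _ (by positivity)).mpr fun x => ?_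
      have h := norm_volterraFun_le hR hq u 0 (c := ‖u‖)
        (fun x => by simpa using u.norm_coe_le_norm x) (norm_nonneg _) x.2
      refine h.trans ?_
      have hle : ∫ t in (0 : ℝ)..x, ‖q t‖ ≤ ∫ t in (0 : ℝ)..R, ‖q t‖ :=
        intervalIntegral.integral_mono_interval le_rfl x.2.1 x.2.2
          (ae_of_all _ fun t => norm_nonneg _) hq.norm
      simp only [CharP.cast_eq_zero, zero_add, div_one, pow_one]
      calc R * ‖u‖ * ∫ t in (0 : ℝ)..x, ‖q t‖ ≤ R * ‖u‖ * ∫ t in (0 : ℝ)..R, ‖q t‖ := by gcongr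
        _ = _ := by ring

lemma volterraCLM_apply {q : ℝ → ℂ} (hq : IntervalIntegrable q volume 0 R)
    (u : C(Set.Icc (0 : ℝ) R, ℂ)) (x : Set.Icc (0 : ℝ) R) :
    volterraCLM hR hq u x = volterraFun hR q u x := rfl

lemma norm_volterraCLM_pow_apply_le {q : ℝ → ℂ} (hq : IntervalIntegrable q volume 0 R)
    (u : C(Set.Icc (0 : ℝ) R, ℂ)) (n : ℕ) (x : Set.Icc (0 : ℝ) R) :
    ‖(volterraCLM hR hq ^ n) u x‖ ≤
      R ^ n * ‖u‖ / n.factorial * (∫ t in (0 : ℝ)..x, ‖q t‖) ^ n := by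
  induction n generalizing x with
  | zero => simpa using u.norm_coe_le_norm x
  | succ n ih =>
    rw [pow_succ', mul_apply_eq_comp, volterraCLM_apply]
    refine (norm_volterraFun_le hR hq _ n ih (by positivity) x.2).trans (le_of_eq ?_)
    rw [Nat.factorial_succ]
    push_cast
    field_simp
    ring

lemma isUnit_one_sub_volterraCLM {q : ℝ → ℂ} (hq : IntervalIntegrable q volume 0 R) :
    IsUnit (1 - volterraCLM hR hq) := by
  set c := R * ∫ t in (0 : ℝ)..R, ‖q t‖ with hc
  have hm0 : 0 ≤ ∫ t in (0 : ℝ)..R, ‖q t‖ :=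
    intervalIntegral.integral_nonneg hR fun t _ => norm_nonneg _
  have hbound : ∀ n : ℕ, ‖volterraCLM hR hq ^ n‖ ≤ c ^ n / n.factorial := by
    intro n
    refine ContinuousLinearMap.opNorm_le_bound _ (by positivity) fun u => ?_
    refine (ContinuousMap.norm_le _ (by positivity)).mpr fun x => ?_
    refine (norm_volterraCLM_pow_apply_le hR hq u n x).trans ?_
    have hle : ∫ t in (0 : ℝ)..x, ‖q t‖ ≤ ∫ t in (0 : ℝ)..R, ‖q t‖ :=
      intervalIntegral.integral_mono_interval le_rfl x.2.1 x.2.2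
        (ae_of_all _ fun t => norm_nonneg _) hq.norm
    have h0 : 0 ≤ ∫ t in (0 : ℝ)..x, ‖q t‖ :=
      intervalIntegral.integral_nonneg x.2.1 fun t _ => norm_nonneg _
    calc _ ≤ R ^ n * ‖u‖ / n.factorial * (∫ t in (0 : ℝ)..R, ‖q t‖) ^ n := by gcongr
      _ = _ := by rw [hc]; ring
  obtain ⟨n, hn⟩ := ((FloorSemiring.tendsto_pow_div_factorial_atTop c).eventually
    (gt_mem_nhds one_pos)).exists
  exact isUnit_one_sub_of_norm_pow_lt_one
    (A := C(Set.Icc (0 : ℝ) R, ℂ) →L[ℂ] C(Set.Icc (0 : ℝ) R, ℂ)) ((hbound n).trans_lt hn)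

lemma volterraCLM_sub_const {q : ℝ → ℂ} (hq : IntervalIntegrable q volume 0 R) (z : ℂ) :
    volterraCLM hR (hq.sub (intervalIntegrable_const (c := z))) =
      volterraCLM hR hq - z • volterraCLM hR (q := fun _ => 1) intervalIntegrable_const := by
  ext u x
  change volterraFun hR (q - fun _ => z) u x =
    volterraFun hR q u x - z * volterraFun hR (fun _ => 1) u x
  have h1 : IntervalIntegrable (fun _ : ℝ => (1 : ℂ)) volume 0 R := intervalIntegrable_const
  unfold volterraFun
  rw [← intervalIntegral.integral_const_mul, ← intervalIntegral.integral_sub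
    (intervalIntegrable_integral_mul_IccExtend hR hq u x.2)
    ((intervalIntegrable_integral_mul_IccExtend hR h1 u x.2).const_mul z)]
  refine intervalIntegral.integral_congr fun s hs => ?_
  rw [Set.uIcc_of_le x.2.1] at hs
  have hs' : s ∈ Set.Icc 0 R := ⟨hs.1, hs.2.trans x.2.2⟩
  rw [← intervalIntegral.integral_const_mul, ← intervalIntegral.integral_sub
    (intervalIntegrable_mul_IccExtend hR hq u hs')
    ((intervalIntegrable_mul_IccExtend hR h1 u hs').const_mul z)]
  congr 1; funext t
  simp [sub_mul]

end Volterra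

/-- Existence of solutions of the initial value problem at `0`, continuously in the spectral
parameter. -/
lemma exists_solODE {R : ℝ} (hR : 0 ≤ R) {V : ℝ → ℂ} (hV : IntervalIntegrable V volume 0 R)
    (α β : ℂ) :
    ∃ u du : ℂ → ℝ → ℂ, ∀ z, SolODE R V z (u z) (du z) ∧ u z 0 = α ∧ du z 0 = β ∧
      TendstoUniformlyOn u (u z) (nhds z) (Set.Icc 0 R) := by
  have hint : ∀ z, IntervalIntegrable (V - fun _ => z) volume 0 R := fun z =>
    hV.sub intervalIntegrable_const
  let K : ℂ → C(Set.Icc (0 : ℝ) R, ℂ) →L[ℂ] C(Set.Icc (0 : ℝ) R, ℂ) := fun z =>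
    volterraCLM hR (hint z)
  have hK : Continuous fun z => 1 - K z := by
    have : K = fun z => volterraCLM hR hV - z • volterraCLM hR (q := fun _ => 1)
        intervalIntegrable_const := funext fun z => volterraCLM_sub_const hR hV z
    rw [this]
    exact continuous_one_sub_sub_smul (E := C(Set.Icc (0 : ℝ) R, ℂ)) _ _
  let f : C(Set.Icc (0 : ℝ) R, ℂ) := ⟨fun x => α + β * (x : ℝ), by fun_prop⟩
  let U : ℂ → C(Set.Icc (0 : ℝ) R, ℂ) := fun z => Ring.inverse (1 - K z) f
  have hU : ∀ z, U z = f + K z (U z) := by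
    intro z
    have h := congrArg (fun T => T f)
      (Ring.mul_inverse_cancel (1 - K z) (isUnit_one_sub_volterraCLM hR (hint z)))
    change U z - K z (U z) = f at h
    rw [← h]; abel
  have hUc : Continuous U := by
    refine continuous_iff_continuousAt.mpr fun z => ?_
    have h2 : ContinuousAt (fun z => Ring.inverse (1 - K z)) z :=
      continuousAt_ringInverse_comp
        (A := C(Set.Icc (0 : ℝ) R, ℂ) →L[ℂ] C(Set.Icc (0 : ℝ) R, ℂ))
        hK.continuousAt (isUnit_one_sub_volterraCLM hR (hint z))
    exact h2.clm_apply continuousAt_const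
  refine ⟨fun z => Set.IccExtend hR (U z),
    fun z x => β + ∫ t in (0 : ℝ)..x, (V t - z) * Set.IccExtend hR (U z) t, fun z => ?_⟩
  have hval : ∀ x ∈ Set.Icc 0 R, Set.IccExtend hR (U z) x =
      α + ∫ s in (0 : ℝ)..x, (β + ∫ t in (0 : ℝ)..s, (V t - z) * Set.IccExtend hR (U z) t) := by
    intro x hx
    have hi := intervalIntegral.integral_add
      (intervalIntegrable_const (c := β) (a := 0) (b := x) (μ := volume))
      (intervalIntegrable_integral_mul_IccExtend hR (hint z) (U z) hx)
    simp only [Pi.sub_apply] at hi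
    rw [hi, intervalIntegral.integral_const, Set.IccExtend_of_mem hR _ hx]
    have h := congrArg (fun g : C(Set.Icc (0 : ℝ) R, ℂ) => g ⟨x, hx⟩) (hU z)
    refine h.trans ?_
    change α + β * (x : ℝ) + volterraFun hR (V - fun _ => z) (U z) x = _
    rw [sub_zero, Complex.real_smul, mul_comm β, add_assoc]
    rfl
  have hcont : ContinuousOn
      (fun s => β + ∫ t in (0 : ℝ)..s, (V t - z) * Set.IccExtend hR (U z) t) (Set.Icc 0 R) :=
    continuousOn_const.add (continuousOn_integral_mul_IccExtend hR (hint z) (U z))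
  refine ⟨⟨fun x hx => ?_, fun x hx => by simp⟩, ?_, by simp, ?_⟩
  · set φ := Set.IccExtend hR ((Set.Icc 0 R).domRestrict
      fun s => β + ∫ t in (0 : ℝ)..s, (V t - z) * Set.IccExtend hR (U z) t) with hφ
    have hφc : Continuous φ := hcont.domRestrict.Icc_extend'
    have hφe : ∀ s ∈ Set.Icc 0 R, φ s =
        β + ∫ t in (0 : ℝ)..s, (V t - z) * Set.IccExtend hR (U z) t := fun s hs =>
      Set.IccExtend_of_mem hR _ hs
    have hd := ((hφc.integral_hasStrictDerivAt 0 x).hasDerivAt.const_add α).hasDerivWithinAt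
      (s := Set.Icc 0 R)
    rw [hφe x hx] at hd
    have heq : ∀ y ∈ Set.Icc 0 R, Set.IccExtend hR (U z) y = α + ∫ s in (0 : ℝ)..y, φ s := by
      intro y hy
      rw [hval y hy]
      congr 1
      refine intervalIntegral.integral_congr fun s hs => ?_
      rw [Set.uIcc_of_le hy.1] at hs
      exact (hφe s ⟨hs.1, hs.2.trans hy.2⟩).symm
    exact hd.congr heq (heq x hx)
  · have := hval 0 ⟨le_rfl, hR⟩
    simpa using this
  · have h := (ContinuousMap.tendsto_iff_tendstoUniformly.mp (hUc.tendsto z))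
    rw [Metric.tendstoUniformly_iff] at h
    rw [Metric.tendstoUniformlyOn_iff]
    intro ε hε
    filter_upwards [h ε hε] with w hw x hx
    rw [Set.IccExtend_of_mem hR _ hx, Set.IccExtend_of_mem hR _ hx]
    exact hw ⟨x, hx⟩

/-! ### Wronskians and dependence on the spectral parameter -/

/-- `u`, with derivative `du`, is a solution of `-u'' + V u = z u + h` on `[0, R]`. -/
def IsSolOn (R : ℝ) (V : ℝ → ℂ) (z : ℂ) (h u du : ℝ → ℂ) : Prop :=
  IsPrimitiveOn u du 0 R ∧ IsPrimitiveOn du (fun t => (V t - z) * u t - h t) 0 R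

lemma isSolOn_of_hasDerivWithinAt {R : ℝ} (hR : 0 ≤ R) {V : ℝ → ℂ}
    (hV : IntervalIntegrable V volume 0 R) {z : ℂ} {h u du : ℝ → ℂ}
    (hh : IntervalIntegrable h volume 0 R)
    (hu : ∀ x ∈ Set.Icc (0 : ℝ) R, HasDerivWithinAt u (du x) (Set.Icc (0 : ℝ) R) x)
    (hdu : ∀ x ∈ Set.Icc (0 : ℝ) R, du x = du 0 + ∫ t in (0 : ℝ)..x, ((V t - z) * u t - h t)) :
    IsSolOn R V z h u du := by
  have huc : ContinuousOn u (Set.uIcc 0 R) := by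
    rw [Set.uIcc_of_le hR]; exact fun x hx => (hu x hx).continuousWithinAt
  have h2 : IsPrimitiveOn du (fun t => (V t - z) * u t - h t) 0 R :=
    ⟨((hV.sub intervalIntegrable_const).mul_continuousOn huc).sub hh, hdu⟩
  exact ⟨.of_hasDerivWithinAt hR hu (h2.continuousOn hR), h2⟩

lemma SolODE.isSolOn {R : ℝ} (hR : 0 ≤ R) {V : ℝ → ℂ} (hV : IntervalIntegrable V volume 0 R)
    {z : ℂ} {u du : ℝ → ℂ} (h : SolODE R V z u du) : IsSolOn R V z 0 u du :=
  isSolOn_of_hasDerivWithinAt hR hV intervalIntegrable_const h.1 (by simpa using h.2)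

namespace IsSolOn

variable {R : ℝ} {V : ℝ → ℂ} {z w : ℂ} {h u du k v dv : ℝ → ℂ}

lemma mono {x : ℝ} (hx : x ∈ Set.Icc 0 R) (hu : IsSolOn R V z h u du) :
    IsSolOn x V z h u du :=
  ⟨hu.1.mono hx.1 hx.2, hu.2.mono hx.1 hx.2⟩

lemma continuousOn (hR : 0 ≤ R) (hu : IsSolOn R V z h u du) : ContinuousOn u (Set.uIcc 0 R) := by
  rw [Set.uIcc_of_le hR]; exact hu.1.continuousOn hR

lemma continuousOn_deriv (hR : 0 ≤ R) (hu : IsSolOn R V z h u du) :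
    ContinuousOn du (Set.uIcc 0 R) := by
  rw [Set.uIcc_of_le hR]; exact hu.2.continuousOn hR

lemma sub (hu : IsSolOn R V z h u du) (hv : IsSolOn R V z h v dv) :
    IsSolOn R V z 0 (u - v) (du - dv) := by
  refine ⟨⟨hu.1.1.sub hv.1.1, fun x hx => ?_⟩, ⟨?_, fun x hx => ?_⟩⟩
  · have e := intervalIntegral.integral_sub (hu.1.mono hx.1 hx.2).1 (hv.1.mono hx.1 hx.2).1
    simp only [Pi.sub_apply]
    rw [e, hu.1.2 x hx, hv.1.2 x hx]; ring
  · refine (hu.2.1.sub hv.2.1).congr (fun t _ => ?_)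
    simp only [Pi.sub_apply, Pi.zero_apply]; ring
  · have e := intervalIntegral.integral_sub (hu.2.mono hx.1 hx.2).1 (hv.2.mono hx.1 hx.2).1
    have e2 : ∀ t, (V t - z) * (u - v) t - (0 : ℝ → ℂ) t =
        ((V t - z) * u t - h t) - ((V t - z) * v t - h t) := by
      intro t; simp only [Pi.sub_apply, Pi.zero_apply]; ring
    simp only [e2]
    simp only [Pi.sub_apply]
    rw [e, hu.2.2 x hx, hv.2.2 x hx]; ring

/-- Lagrange's identity. -/
lemma lagrange (hR : 0 ≤ R) (hu : IsSolOn R V z h u du) (hv : IsSolOn R V w k v dv) :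
    (du R * v R - u R * dv R) - (du 0 * v 0 - u 0 * dv 0) =
      ∫ t in (0 : ℝ)..R, ((w - z) * (u t * v t) - h t * v t + u t * k t) := by
  have h1 := IsPrimitiveOn.integral_mul hR hu.2 hv.1
  have h2 := IsPrimitiveOn.integral_mul hR hu.1 hv.2
  have cu := hu.continuousOn hR
  have cv := hv.continuousOn hR
  have i1 : IntervalIntegrable (fun t => ((V t - z) * u t - h t) * v t + du t * dv t)
      volume 0 R := (hu.2.1.mul_continuousOn cv).add
        (hu.1.1.mul_continuousOn (hv.continuousOn_deriv hR))
  have i2 : IntervalIntegrable (fun t => du t * v t * 0 + du t * dv t +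
      u t * ((V t - w) * v t - k t)) volume 0 R := by
    refine IntervalIntegrable.add ?_ (hv.2.1.continuousOn_mul cu)
    simpa using hu.1.1.mul_continuousOn (hv.continuousOn_deriv hR)
  simp only [mul_zero, zero_add] at i2
  have e : (du R * v R - u R * dv R) - (du 0 * v 0 - u 0 * dv 0) =
      (du R * v R - du 0 * v 0) - (u R * dv R - u 0 * dv 0) := by ring
  rw [e, ← h1, ← h2, ← intervalIntegral.integral_sub i1 i2]
  congr 1; funext t; ring

lemma wronskian (hu : IsSolOn R V z 0 u du) (hv : IsSolOn R V z 0 v dv) {x : ℝ}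
    (hx : x ∈ Set.Icc 0 R) : u x * dv x - du x * v x = u 0 * dv 0 - du 0 * v 0 := by
  have h := lagrange hx.1 (hu.mono hx) (hv.mono hx)
  simp only [sub_self, zero_mul, Pi.zero_apply, mul_zero, add_zero,
    intervalIntegral.integral_zero] at h
  linear_combination -h

/-- Every solution is a linear combination of the fundamental system. -/
lemma eq_fundamental {u₁ du₁ u₂ du₂ : ℝ → ℂ} (h1 : IsSolOn R V z 0 u₁ du₁)
    (h2 : IsSolOn R V z 0 u₂ du₂) (hu1 : u₁ 0 = 1) (hdu1 : du₁ 0 = 0) (hu2 : u₂ 0 = 0)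
    (hdu2 : du₂ 0 = 1) (hu : IsSolOn R V z 0 u du) {x : ℝ} (hx : x ∈ Set.Icc 0 R) :
    u x = u 0 * u₁ x + du 0 * u₂ x ∧ du x = u 0 * du₁ x + du 0 * du₂ x := by
  have w := wronskian h1 h2 hx
  have w1 := wronskian hu h1 hx
  have w2 := wronskian hu h2 hx
  rw [hu1, hdu1, hu2, hdu2] at w
  rw [hu1, hdu1] at w1
  rw [hu2, hdu2] at w2
  constructor
  · linear_combination (-u x) * w + u₁ x * w2 - u₂ x * w1
  · linear_combination (-du x) * w + du₁ x * w2 - du₂ x * w1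

end IsSolOn

/-- Derivatives with respect to the spectral parameter of the boundary values at `R` of a family
of solutions with fixed initial values. -/
lemma hasDerivAt_isSolOn_right {R : ℝ} (hR : 0 ≤ R) {V : ℝ → ℂ} {z α β : ℂ}
    {u du : ℂ → ℝ → ℂ} (hu : ∀ w, IsSolOn R V w 0 (u w) (du w)) (hα : ∀ w, u w 0 = α)
    (hβ : ∀ w, du w 0 = β) (hc : TendstoUniformlyOn u (u z) (nhds z) (Set.Icc 0 R))
    {v₁ dv₁ v₂ dv₂ : ℝ → ℂ} (h1 : IsSolOn R V z 0 v₁ dv₁) (h2 : IsSolOn R V z 0 v₂ dv₂)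
    (hw : v₁ R * dv₂ R - dv₁ R * v₂ R = 1) :
    HasDerivAt (fun w => u w R) ((∫ t in (0 : ℝ)..R, u z t * v₂ t) * v₁ R -
      (∫ t in (0 : ℝ)..R, u z t * v₁ t) * v₂ R) z ∧
    HasDerivAt (fun w => du w R) ((∫ t in (0 : ℝ)..R, u z t * v₂ t) * dv₁ R -
      (∫ t in (0 : ℝ)..R, u z t * v₁ t) * dv₂ R) z := by
  have key : ∀ {v dv : ℝ → ℂ}, IsSolOn R V z 0 v dv →
      Tendsto (fun w => ∫ t in (0 : ℝ)..R, u w t * v t) (nhds z)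
        (nhds (∫ t in (0 : ℝ)..R, u z t * v t)) ∧
      ∀ w, (du w R - du z R) * v R - (u w R - u z R) * dv R =
        -(w - z) * ∫ t in (0 : ℝ)..R, u w t * v t := by
    intro v dv hv
    constructor
    · obtain ⟨M, hM⟩ := isCompact_uIcc.exists_bound_of_continuousOn (hv.continuousOn hR)
      have hM0 : 0 ≤ M := (norm_nonneg _).trans (hM 0 Set.left_mem_uIcc)
      rw [Metric.tendsto_nhds]
      intro ε hε
      have hpos : 0 < ε / (M * R + 1) := by positivity
      filter_upwards [Metric.tendstoUniformlyOn_iff.mp hc _ hpos] with w hw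
      have hi : ∀ y, IntervalIntegrable (fun t => u y t * v t) volume 0 R := fun y =>
        (((hu y).continuousOn hR).mul (hv.continuousOn hR)).intervalIntegrable
      rw [dist_eq_norm, ← intervalIntegral.integral_sub (hi w) (hi z)]
      have hle := intervalIntegral.norm_integral_le_of_norm_le_const (a := 0) (b := R)
        (f := fun t => u w t * v t - u z t * v t) (C := ε / (M * R + 1) * M) (fun t ht => by
          have ht' := Set.uIoc_subset_uIcc ht
          rw [← sub_mul, norm_mul]
          have h3 := hM t ht'
          rw [Set.uIcc_of_le hR] at ht'
          have h4 := (hw t ht').le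
          rw [dist_comm, dist_eq_norm] at h4
          gcongr)
      refine hle.trans_lt ?_
      rw [sub_zero, abs_of_nonneg hR, mul_assoc, div_mul_eq_mul_div, div_lt_iff₀ (by positivity)]
      nlinarith
    · intro w
      have e1 := (hu w).lagrange hR hv
      have e2 := (hu z).lagrange hR hv
      simp only [Pi.zero_apply, zero_mul, mul_zero, sub_zero, add_zero, sub_self,
        intervalIntegral.integral_zero, intervalIntegral.integral_const_mul] at e1 e2
      rw [hα, hβ] at e1 e2
      linear_combination e1 - e2
  obtain ⟨t1, k1⟩ := key h1
  obtain ⟨t2, k2⟩ := key h2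
  refine ⟨?_, ?_⟩
  · rw [hasDerivAt_iff_tendsto_slope]
    refine Tendsto.congr' ?_ (((t2.mul_const _).sub (t1.mul_const _)).mono_left
      nhdsWithin_le_nhds)
    filter_upwards [self_mem_nhdsWithin] with w hwz
    rw [slope_def_field, eq_div_iff (sub_ne_zero.mpr hwz)]
    linear_combination v₁ R * k2 w - v₂ R * k1 w + (u w R - u z R) * hw
  · rw [hasDerivAt_iff_tendsto_slope]
    refine Tendsto.congr' ?_ (((t2.mul_const _).sub (t1.mul_const _)).mono_left
      nhdsWithin_le_nhds)
    filter_upwards [self_mem_nhdsWithin] with w hwz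
    rw [slope_def_field, eq_div_iff (sub_ne_zero.mpr hwz)]
    linear_combination dv₁ R * k2 w - dv₂ R * k1 w + (du w R - du z R) * hw

/-! ### Solutions representing the resolvent and the boundary determinant -/

section BoundaryProblem

lemma intervalIntegrable_of_schSp {R : ℝ} (hR : 0 ≤ R) (h : SchSp R) :
    IntervalIntegrable h volume 0 R := by
  rw [intervalIntegrable_iff_integrableOn_Ioo_of_le hR]
  exact (Lp.memLp h).integrable one_le_two

lemma memLp_of_continuousOn_uIcc {R : ℝ} {u : ℝ → ℂ} (hu : ContinuousOn u (Set.uIcc 0 R)) :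
    MemLp u 2 (volume.restrict (Set.Ioo 0 R)) := by
  obtain ⟨M, hM⟩ := isCompact_uIcc.exists_bound_of_continuousOn hu
  have hsub : Set.Ioo 0 R ⊆ Set.uIcc 0 R := Set.Ioo_subset_Icc_self.trans Set.Icc_subset_uIcc
  refine MemLp.of_bound ((hu.mono hsub).aestronglyMeasurable measurableSet_Ioo) M ?_
  filter_upwards [ae_restrict_mem measurableSet_Ioo] with x hx
  exact hM x (hsub hx)

lemma inner_schSp {R : ℝ} (hR : 0 ≤ R) {f g : SchSp R} {u v : ℝ → ℂ}
    (hf : ∀ᵐ x ∂(volume.restrict (Set.Ioo (0 : ℝ) R)), f x = u x)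
    (hg : ∀ᵐ x ∂(volume.restrict (Set.Ioo (0 : ℝ) R)), g x = v x) :
    ⟪f, g⟫_ℂ = ∫ t in (0 : ℝ)..R, v t * starRingEnd ℂ (u t) := by
  rw [L2.inner_def, intervalIntegral.integral_of_le hR, integral_Ioc_eq_integral_Ioo]
  refine integral_congr_ae ?_
  filter_upwards [hf, hg] with x h1 h2
  rw [h1, h2, RCLike.inner_apply]

lemma exists_isSolOn_of_mem_graph {R : ℝ} (hR : 0 ≤ R) {V : ℝ → ℂ}
    (hV : IntervalIntegrable V volume 0 R) {t0 tR : ℂ} {A : SchSp R →ₗ.[ℂ] SchSp R}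
    (hA : IsSchrodingerOp R V t0 tR A) {z : ℂ} {f h : SchSp R} (hf : (f, h + z • f) ∈ A.graph) :
    ∃ g dg : ℝ → ℂ, (∀ᵐ x ∂(volume.restrict (Set.Ioo (0 : ℝ) R)), f x = g x) ∧
      IsSolOn R V z h g dg ∧ bdryC R t0 tR g dg = 0 := by
  obtain ⟨g, dg, ⟨hfg, hg, h0, hh0, hdg⟩, hb⟩ := (hA f _).mp hf
  refine ⟨g, dg, hfg, isSolOn_of_hasDerivWithinAt hR hV (intervalIntegrable_of_schSp hR h) hg
    fun x hx => ?_, hb⟩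
  rw [hdg x hx]
  congr 1
  rw [intervalIntegral.integral_of_le hx.1, intervalIntegral.integral_of_le hx.1,
    integral_Ioc_eq_integral_Ioo, integral_Ioc_eq_integral_Ioo]
  have hle : volume.restrict (Set.Ioo 0 x) ≤ volume.restrict (Set.Ioo 0 R) :=
    Measure.restrict_mono (Set.Ioo_subset_Ioo_right hx.2) le_rfl
  refine integral_congr_ae (ae_mono hle ?_)
  filter_upwards [hfg, hh0, Lp.coeFn_add h (z • f), Lp.coeFn_smul z f] with t e1 e2 e3 e4
  rw [← e2, e3, Pi.add_apply, e4, Pi.smul_apply, e1, smul_eq_mul]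
  ring

lemma SolODE.linearCombination {R : ℝ} {V : ℝ → ℂ} (hR : 0 ≤ R)
    (hV : IntervalIntegrable V volume 0 R) {z : ℂ} {u du v dv : ℝ → ℂ}
    (hu : SolODE R V z u du) (hv : SolODE R V z v dv) (α β : ℂ) :
    SolODE R V z (fun x => α * u x + β * v x) (fun x => α * du x + β * dv x) := by
  have hu' := hu.isSolOn hR hV
  have hv' := hv.isSolOn hR hV
  refine ⟨fun x hx => ((hu.1 x hx).const_mul α).add ((hv.1 x hx).const_mul β), fun x hx => ?_⟩
  have iu := (hu'.2.mono hx.1 hx.2).1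
  have iv := (hv'.2.mono hx.1 hx.2).1
  simp only [Pi.zero_apply, sub_zero] at iu iv
  have e : ∀ t, (V t - z) * (α * u t + β * v t) =
      α * ((V t - z) * u t) + β * ((V t - z) * v t) := fun t => by ring
  simp only [e]
  rw [intervalIntegral.integral_add (iu.const_mul α) (iv.const_mul β),
    intervalIntegral.integral_const_mul, intervalIntegral.integral_const_mul,
    hu.2 x hx, hv.2 x hx]
  ring

/-- A solution satisfying the homogeneous boundary conditions vanishes at `0` together with its
derivative, away from the spectrum. -/
lemma SolODE.eq_zero_of_bdryC_eq_zero {R : ℝ} (hR : 0 < R) {V : ℝ → ℂ}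
    (hV : IntervalIntegrable V volume 0 R) {t0 tR : ℂ} {A : SchSp R →ₗ.[ℂ] SchSp R}
    (hA : IsSchrodingerOp R V t0 tR A) {z : ℂ} (hz : z ∈ resolventSetP A) {u du : ℝ → ℂ}
    (hu : SolODE R V z u du) (hb : bdryC R t0 tR u du = 0) : u 0 = 0 ∧ du 0 = 0 := by
  have hc := (hu.isSolOn hR.le hV).continuousOn hR.le
  have hmem := memLp_of_continuousOn_uIcc hc
  have hae := hmem.coeFn_toLp
  have hgraph : (hmem.toLp u, z • hmem.toLp u) ∈ A.graph := by
    refine (hA _ _).mpr ⟨u, du, ⟨hae, hu.1, fun t => z * u t, ?_, fun x hx => ?_⟩, hb⟩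
    · filter_upwards [hae, Lp.coeFn_smul z (hmem.toLp u)] with x h1 h2
      rw [h2, Pi.smul_apply, h1, smul_eq_mul]
    · rw [hu.2 x hx]
      congr 2; funext t; ring
  have h0 := eq_zero_of_mem_graph_smul hz hgraph
  have hzero : ∀ x ∈ Set.Icc 0 R, u x = 0 := by
    have h1 : u =ᵐ[volume.restrict (Set.Ioo 0 R)] 0 := by
      rw [h0] at hae
      filter_upwards [hae, Lp.coeFn_zero ℂ 2 (volume.restrict (Set.Ioo 0 R))] with x e1 e2
      rw [← e1, e2]
    rw [Set.uIcc_of_le hR.le] at hc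
    exact Measure.eqOn_Icc_of_ae_eq volume hR.ne
      (by rwa [← restrict_Ioo_eq_restrict_Icc]) hc continuousOn_const
  have hm0 : (0 : ℝ) ∈ Set.Icc 0 R := ⟨le_rfl, hR.le⟩
  refine ⟨hzero 0 hm0, ?_⟩
  have hd : HasDerivWithinAt u 0 (Set.Icc 0 R) 0 :=
    (hasDerivWithinAt_const 0 _ 0).congr hzero (hzero 0 hm0)
  exact (uniqueDiffOn_Icc hR 0 hm0).eq_deriv _ (hu.1 0 hm0) hd

/-- The determinant of the matrix with columns `γ(u₁)`, `γ(u₂)`. -/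
def bdryDet (R : ℝ) (t0 tR : ℂ) (u₁ du₁ u₂ du₂ : ℝ → ℂ) : ℂ :=
  bdryC R t0 tR u₁ du₁ 0 * bdryC R t0 tR u₂ du₂ 1 -
    bdryC R t0 tR u₂ du₂ 0 * bdryC R t0 tR u₁ du₁ 1

/-- `u₁, u₂` is the fundamental system of `-u'' + V u = z u` normalized at `0`. -/
structure IsFundamental (R : ℝ) (V : ℝ → ℂ) (z : ℂ) (u₁ du₁ u₂ du₂ : ℝ → ℂ) : Prop where
  sol₁ : SolODE R V z u₁ du₁
  sol₂ : SolODE R V z u₂ du₂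
  val₁ : u₁ 0 = 1
  deriv₁ : du₁ 0 = 0
  val₂ : u₂ 0 = 0
  deriv₂ : du₂ 0 = 1

namespace IsFundamental

variable {R : ℝ} {V : ℝ → ℂ} {z t0 tR t0' tR' : ℂ} {u₁ du₁ u₂ du₂ : ℝ → ℂ}

lemma wronskian (hu : IsFundamental R V z u₁ du₁ u₂ du₂) (hR : 0 ≤ R)
    (hV : IntervalIntegrable V volume 0 R) : u₁ R * du₂ R - du₁ R * u₂ R = 1 := by
  rw [(hu.sol₁.isSolOn hR hV).wronskian (hu.sol₂.isSolOn hR hV) ⟨hR, le_rfl⟩,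
    hu.val₁, hu.deriv₁, hu.deriv₂]
  simp

lemma bdryDet_eq (hu : IsFundamental R V z u₁ du₁ u₂ du₂) :
    bdryDet R t0 tR u₁ du₁ u₂ du₂ =
      Complex.cos t0 * (Complex.cos tR * u₂ R - Complex.sin tR * du₂ R) -
      Complex.sin t0 * (Complex.cos tR * u₁ R - Complex.sin tR * du₁ R) := by
  simp [bdryDet, bdryC, hu.val₁, hu.deriv₁, hu.val₂, hu.deriv₂]

lemma bdryDet_ne_zero (hu : IsFundamental R V z u₁ du₁ u₂ du₂) (hR : 0 < R)
    (hV : IntervalIntegrable V volume 0 R) {A : SchSp R →ₗ.[ℂ] SchSp R}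
    (hA : IsSchrodingerOp R V t0 tR A) (hz : z ∈ resolventSetP A) :
    bdryDet R t0 tR u₁ du₁ u₂ du₂ ≠ 0 := by
  intro h0
  rw [hu.bdryDet_eq] at h0
  have hsol := hu.sol₁.linearCombination hR.le hV hu.sol₂ (Complex.sin t0) (-Complex.cos t0)
  have h := hsol.eq_zero_of_bdryC_eq_zero hR hV hA hz (by
    ext i
    fin_cases i
    · simp [bdryC, hu.val₁, hu.deriv₁, hu.val₂, hu.deriv₂]; ring
    · simp only [bdryC, Fin.mk_one, Matrix.cons_val_one, Matrix.cons_val_fin_one, Pi.zero_apply]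
      linear_combination -h0)
  simp only [hu.val₁, hu.deriv₁, hu.val₂, hu.deriv₂] at h
  have := Complex.sin_sq_add_cos_sq t0
  have h1 : Complex.sin t0 = 0 := by linear_combination h.1
  have h2 : Complex.cos t0 = 0 := by linear_combination -h.2
  simp [h1, h2] at this

lemma det_mul_bdryDet (hu : IsFundamental R V z u₁ du₁ u₂ du₂)
    {Λ : Matrix (Fin 2) (Fin 2) ℂ} (hΛ : IsBoundaryDataMap R V t0 tR t0' tR' z Λ) :
    Λ.det * bdryDet R t0 tR u₁ du₁ u₂ du₂ = bdryDet R t0' tR' u₁ du₁ u₂ du₂ := by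
  have h1 := hΛ _ _ hu.sol₁
  have h2 := hΛ _ _ hu.sol₂
  rw [bdryDet, bdryDet, ← h1, ← h2, Matrix.det_fin_two]
  simp only [Matrix.mulVec, dotProduct, Fin.sum_univ_two]
  ring

end IsFundamental

end BoundaryProblem

/-! ### The trace of the resolvent difference -/

lemma traceH_eq_sum_of_apply_eq {E ι : Type*} [NormedAddCommGroup E] [InnerProductSpace ℂ E]
    [Fintype ι] (b : HilbertBasis ℕ ℂ E) {T : E →L[ℂ] E} {v w : ι → E}
    (hT : ∀ x, T x = ∑ i, ⟪v i, x⟫_ℂ • w i) : traceH b T = ∑ i, ⟪v i, w i⟫_ℂ := by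
  have h := hasSum_sum (s := Finset.univ) fun i _ => b.hasSum_inner_mul_inner (v i) (w i)
  rw [traceH, ← h.tsum_eq]
  refine tsum_congr fun n => ?_
  rw [hT, inner_sum]
  simp only [inner_smul_right]

/-- Linear algebra behind Krein's resolvent formula: the initial values `d0`, `e0` of the difference
of two solutions with different boundary conditions, in terms of the moments `H1`, `H2` of the
inhomogeneity. -/
lemma krein_coefficients {c0 s0 cR sR c0' s0' cR' sR' a1 b1 a2 b2 H1 H2 g0 gR dg0 dgR d0 e0 : ℂ}
    (h0 : s0 ^ 2 + c0 ^ 2 = 1) (hR : sR ^ 2 + cR ^ 2 = 1)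
    (hg0 : c0 * g0 + s0 * dg0 = 0) (hgR : cR * gR - sR * dgR = 0)
    (l1 : dgR * a1 - gR * b1 - dg0 = -H1) (l2 : dgR * a2 - gR * b2 + g0 = -H2)
    (hd0 : c0' * (g0 + d0) + s0' * (dg0 + e0) = 0)
    (hdR : cR' * (gR + (d0 * a1 + e0 * a2)) - sR' * (dgR + (d0 * b1 + e0 * b2)) = 0) :
    (c0 * (cR * a2 - sR * b2) - s0 * (cR * a1 - sR * b1)) *
        (c0' * (cR' * a2 - sR' * b2) - s0' * (cR' * a1 - sR' * b1)) * d0 =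
      ((cR' * a2 - sR' * b2) * (s0 * c0' - c0 * s0') * (cR * a2 - sR * b2) +
        s0' * (sR * cR' - cR * sR') * s0) * H1 -
      ((cR' * a2 - sR' * b2) * (s0 * c0' - c0 * s0') * (cR * a1 - sR * b1) +
        s0' * (sR * cR' - cR * sR') * c0) * H2 ∧
    (c0 * (cR * a2 - sR * b2) - s0 * (cR * a1 - sR * b1)) *
        (c0' * (cR' * a2 - sR' * b2) - s0' * (cR' * a1 - sR' * b1)) * e0 =
      ((cR' * a1 - sR' * b1) * (s0 * c0' - c0 * s0') * (cR * a1 - sR * b1) +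
        c0' * (sR * cR' - cR * sR') * c0) * H2 -
      ((cR' * a1 - sR' * b1) * (s0 * c0' - c0 * s0') * (cR * a2 - sR * b2) +
        c0' * (sR * cR' - cR * sR') * s0) * H1 := by
  obtain ⟨α, hα1, hα2⟩ : ∃ α, g0 = α * s0 ∧ dg0 = -α * c0 :=
    ⟨s0 * g0 - c0 * dg0, by linear_combination (-g0) * h0 + c0 * hg0,
      by linear_combination (-dg0) * h0 + s0 * hg0⟩
  obtain ⟨β, hβ1, hβ2⟩ : ∃ β, gR = β * sR ∧ dgR = β * cR :=
    ⟨sR * gR + cR * dgR, by linear_combination (-gR) * hR + cR * hgR,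
      by linear_combination (-dgR) * hR - sR * hgR⟩
  subst hα1 hα2 hβ1 hβ2
  set P1 := cR * a1 - sR * b1 with hP1
  set P2 := cR * a2 - sR * b2 with hP2
  set Q1 := cR' * a1 - sR' * b1 with hQ1
  set Q2 := cR' * a2 - sR' * b2 with hQ2
  have e1 : β * P1 + α * c0 = -H1 := by linear_combination l1
  have e2 : β * P2 + α * s0 = -H2 := by linear_combination l2
  have hα : α * (c0 * P2 - s0 * P1) = H2 * P1 - H1 * P2 := by
    linear_combination P2 * e1 - P1 * e2
  have hβ : β * (c0 * P2 - s0 * P1) = s0 * H1 - c0 * H2 := by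
    linear_combination c0 * e2 - s0 * e1
  have f1 : c0' * d0 + s0' * e0 = -α * (s0 * c0' - c0 * s0') := by linear_combination hd0
  have f2 : Q1 * d0 + Q2 * e0 = -β * (sR * cR' - cR * sR') := by linear_combination hdR
  constructor
  · linear_combination (c0 * P2 - s0 * P1) * (Q2 * f1 - s0' * f2) -
      Q2 * (s0 * c0' - c0 * s0') * hα + s0' * (sR * cR' - cR * sR') * hβ
  · linear_combination (c0 * P2 - s0 * P1) * (c0' * f2 - Q1 * f1) +
      Q1 * (s0 * c0' - c0 * s0') * hα - c0' * (sR * cR' - cR * sR') * hβ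

section ResolventDifference

variable {R : ℝ} {V : ℝ → ℂ} {z t0 tR t0' tR' : ℂ} {u₁ du₁ u₂ du₂ : ℝ → ℂ}

/-- Moment of `h` against a solution of the homogeneous equation, as a boundary term. -/
lemma IsSolOn.lagrange_homogeneous {h g dg u du : ℝ → ℂ} (hR : 0 ≤ R) (hg : IsSolOn R V z h g dg)
    (hu : IsSolOn R V z 0 u du) :
    (dg R * u R - g R * du R) - (dg 0 * u 0 - g 0 * du 0) = -∫ t in (0 : ℝ)..R, h t * u t := by
  rw [hg.lagrange hR hu, ← intervalIntegral.integral_neg]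
  congr 1; funext t
  simp

/-- The derivative of `bdryDet` with respect to the spectral parameter. -/
def bdryDetDeriv (R : ℝ) (t0 tR : ℂ) (u₁ du₁ u₂ du₂ : ℝ → ℂ) : ℂ :=
  Complex.cos t0 *
      ((∫ t in (0 : ℝ)..R, u₂ t * u₂ t) * (Complex.cos tR * u₁ R - Complex.sin tR * du₁ R) -
        (∫ t in (0 : ℝ)..R, u₁ t * u₂ t) * (Complex.cos tR * u₂ R - Complex.sin tR * du₂ R)) -
    Complex.sin t0 *
      ((∫ t in (0 : ℝ)..R, u₁ t * u₂ t) * (Complex.cos tR * u₁ R - Complex.sin tR * du₁ R) -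
        (∫ t in (0 : ℝ)..R, u₁ t * u₁ t) * (Complex.cos tR * u₂ R - Complex.sin tR * du₂ R))

/-- The trace of the difference of two resolvents of Schrödinger operators with different
boundary conditions. -/
lemma IsFundamental.bdryDet_mul_traceH (hu : IsFundamental R V z u₁ du₁ u₂ du₂) (hR : 0 < R)
    (hV : IntervalIntegrable V volume 0 R) {A A' : SchSp R →ₗ.[ℂ] SchSp R}
    (hA : IsSchrodingerOp R V t0 tR A) (hA' : IsSchrodingerOp R V t0' tR' A')
    (hz : z ∈ resolventSetP A) (hz' : z ∈ resolventSetP A') (b : HilbertBasis ℕ ℂ (SchSp R)) :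
    bdryDet R t0 tR u₁ du₁ u₂ du₂ * bdryDet R t0' tR' u₁ du₁ u₂ du₂ *
        traceH b (res A' z - res A z) =
      bdryDetDeriv R t0 tR u₁ du₁ u₂ du₂ * bdryDet R t0' tR' u₁ du₁ u₂ du₂ -
        bdryDet R t0 tR u₁ du₁ u₂ du₂ * bdryDetDeriv R t0' tR' u₁ du₁ u₂ du₂ := by
  have hD := hu.bdryDet_ne_zero hR hV hA hz
  have hD' := hu.bdryDet_ne_zero hR hV hA' hz'
  have hW := hu.wronskian hR.le hV
  have s1 := hu.sol₁.isSolOn hR.le hV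
  have s2 := hu.sol₂.isSolOn hR.le hV
  have c1 := s1.continuousOn hR.le
  have c2 := s2.continuousOn hR.le
  have m1 := memLp_of_continuousOn_uIcc c1
  have m2 := memLp_of_continuousOn_uIcc c2
  have k1 := memLp_of_continuousOn_uIcc (Complex.continuous_conj.comp_continuousOn c1)
  have k2 := memLp_of_continuousOn_uIcc (Complex.continuous_conj.comp_continuousOn c2)
  have hmom1 : ∀ {f : SchSp R} {g : ℝ → ℂ},
      (∀ᵐ x ∂(volume.restrict (Set.Ioo (0 : ℝ) R)), f x = g x) →
      ⟪k1.toLp _, f⟫_ℂ = ∫ t in (0 : ℝ)..R, g t * u₁ t := fun hfg => by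
    simpa using inner_schSp hR.le k1.coeFn_toLp hfg
  have hmom2 : ∀ {f : SchSp R} {g : ℝ → ℂ},
      (∀ᵐ x ∂(volume.restrict (Set.Ioo (0 : ℝ) R)), f x = g x) →
      ⟪k2.toLp _, f⟫_ℂ = ∫ t in (0 : ℝ)..R, g t * u₂ t := fun hfg => by
    simpa using inner_schSp hR.le k2.coeFn_toLp hfg
  rw [hu.bdryDet_eq] at hD hD' ⊢
  rw [hu.bdryDet_eq]
  unfold bdryDetDeriv
  have hp0 := Complex.sin_sq_add_cos_sq t0
  have hpR := Complex.sin_sq_add_cos_sq tR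
  set c0 := Complex.cos t0
  set s0 := Complex.sin t0
  set cR := Complex.cos tR
  set sR := Complex.sin tR
  set c0' := Complex.cos t0'
  set s0' := Complex.sin t0'
  set cR' := Complex.cos tR'
  set sR' := Complex.sin tR'
  set D := c0 * (cR * u₂ R - sR * du₂ R) - s0 * (cR * u₁ R - sR * du₁ R) with hDdef
  set D' := c0' * (cR' * u₂ R - sR' * du₂ R) - s0' * (cR' * u₁ R - sR' * du₁ R) with hDdef'
  set N11 := (cR' * u₂ R - sR' * du₂ R) * (s0 * c0' - c0 * s0') * (cR * u₂ R - sR * du₂ R) +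
    s0' * (sR * cR' - cR * sR') * s0 with hN11
  set N12 := (cR' * u₂ R - sR' * du₂ R) * (s0 * c0' - c0 * s0') * (cR * u₁ R - sR * du₁ R) +
    s0' * (sR * cR' - cR * sR') * c0 with hN12
  set N21 := (cR' * u₁ R - sR' * du₁ R) * (s0 * c0' - c0 * s0') * (cR * u₂ R - sR * du₂ R) +
    c0' * (sR * cR' - cR * sR') * s0 with hN21
  set N22 := (cR' * u₁ R - sR' * du₁ R) * (s0 * c0' - c0 * s0') * (cR * u₁ R - sR * du₁ R) +
    c0' * (sR * cR' - cR * sR') * c0 with hN22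
  have hT : ∀ h, (res A' z - res A z) h = ∑ i : Fin 2, ⟪![k1.toLp _, k2.toLp _] i, h⟫_ℂ •
      (![(D * D')⁻¹ • (N11 • m1.toLp u₁ - N21 • m2.toLp u₂),
        (D * D')⁻¹ • (N22 • m2.toLp u₂ - N12 • m1.toLp u₁)] : Fin 2 → SchSp R) i := by
    intro h
    obtain ⟨g, dg, hfg, hg, hgb⟩ := exists_isSolOn_of_mem_graph hR.le hV hA (res_mem_graph hz h)
    obtain ⟨g', dg', hfg', hg', hgb'⟩ :=
      exists_isSolOn_of_mem_graph hR.le hV hA' (res_mem_graph hz' h)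
    have hd := hg'.sub hg
    have hrep := fun {x : ℝ} (hx : x ∈ Set.Icc 0 R) =>
      s1.eq_fundamental s2 hu.val₁ hu.deriv₁ hu.val₂ hu.deriv₂ hd hx
    have l1 := hg.lagrange_homogeneous hR.le s1
    have l2 := hg.lagrange_homogeneous hR.le s2
    rw [hu.val₁, hu.deriv₁] at l1
    rw [hu.val₂, hu.deriv₂] at l2
    obtain ⟨r1, r2⟩ := hrep ⟨hR.le, le_rfl⟩
    have b0 := congrFun hgb 0
    have b1 := congrFun hgb 1
    have b0' := congrFun hgb' 0
    have b1' := congrFun hgb' 1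
    simp only [bdryC, Matrix.cons_val_zero, Matrix.cons_val_one, Matrix.cons_val_fin_one,
      Pi.zero_apply] at b0 b1 b0' b1'
    simp only [Pi.sub_apply] at r1 r2
    obtain ⟨q1, q2⟩ := krein_coefficients (H1 := ∫ t in (0 : ℝ)..R, h t * u₁ t)
      (H2 := ∫ t in (0 : ℝ)..R, h t * u₂ t) (d0 := g' 0 - g 0) (e0 := dg' 0 - dg 0)
      (c0' := c0') (s0' := s0') (cR' := cR') (sR' := sR') (a1 := u₁ R) (b1 := du₁ R)
      (a2 := u₂ R) (b2 := du₂ R) hp0 hpR b0 b1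
      (by linear_combination l1) (by linear_combination l2)
      (by linear_combination b0')
      (by rw [← r1, ← r2]; linear_combination b1')
    rw [Fin.sum_univ_two]
    simp only [Matrix.cons_val_zero, Matrix.cons_val_one, Matrix.cons_val_fin_one]
    rw [hmom1 (ae_of_all _ fun _ => rfl), hmom2 (ae_of_all _ fun _ => rfl)]
    set H1 := ∫ t in (0 : ℝ)..R, h t * u₁ t
    set H2 := ∫ t in (0 : ℝ)..R, h t * u₂ t
    have hcomb : H1 • ((D * D')⁻¹ • (N11 • m1.toLp u₁ - N21 • m2.toLp u₂)) +
        H2 • ((D * D')⁻¹ • (N22 • m2.toLp u₂ - N12 • m1.toLp u₁)) =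
        (g' 0 - g 0) • m1.toLp u₁ + (dg' 0 - dg 0) • m2.toLp u₂ := by
      have e1 : g' 0 - g 0 = (D * D')⁻¹ * (N11 * H1 - N12 * H2) := by
        rw [eq_inv_mul_iff_mul_eq₀ (mul_ne_zero hD hD')]; exact q1
      have e2 : dg' 0 - dg 0 = (D * D')⁻¹ * (N22 * H2 - N21 * H1) := by
        rw [eq_inv_mul_iff_mul_eq₀ (mul_ne_zero hD hD')]; exact q2
      rw [e1, e2]
      module
    rw [hcomb]
    refine Lp.ext ?_
    filter_upwards [hfg, hfg', m1.coeFn_toLp, m2.coeFn_toLp,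
      Lp.coeFn_sub (res A' z h) (res A z h),
      Lp.coeFn_add ((g' 0 - g 0) • m1.toLp u₁) ((dg' 0 - dg 0) • m2.toLp u₂),
      Lp.coeFn_smul (g' 0 - g 0) (m1.toLp u₁), Lp.coeFn_smul (dg' 0 - dg 0) (m2.toLp u₂),
      ae_restrict_mem measurableSet_Ioo] with x x1 x2 x3 x4 x5 x6 x7 x8 x9
    change (res A' z h - res A z h) x = _
    rw [x5, x6, Pi.sub_apply, Pi.add_apply, x7, x8, Pi.smul_apply, Pi.smul_apply, x1, x2, x3, x4]
    exact (hrep ⟨x9.1.le, x9.2.le⟩).1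
  rw [traceH_eq_sum_of_apply_eq b hT, Fin.sum_univ_two]
  simp only [Matrix.cons_val_zero, Matrix.cons_val_one, Matrix.cons_val_fin_one,
    inner_smul_right, inner_sub_right]
  rw [hmom1 m1.coeFn_toLp, hmom1 m2.coeFn_toLp, hmom2 m1.coeFn_toLp, hmom2 m2.coeFn_toLp]
  have hsymm : ∫ t in (0 : ℝ)..R, u₂ t * u₁ t = ∫ t in (0 : ℝ)..R, u₁ t * u₂ t := by
    congr 1; funext t; ring
  rw [hsymm]
  set U11 := ∫ t in (0 : ℝ)..R, u₁ t * u₁ t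
  set U12 := ∫ t in (0 : ℝ)..R, u₁ t * u₂ t
  set U22 := ∫ t in (0 : ℝ)..R, u₂ t * u₂ t
  have hcancel : ∀ x y : ℂ, D * D' * ((D * D')⁻¹ * x + (D * D')⁻¹ * y) = x + y := by
    intro x y; field_simp
  rw [hcancel, hN11, hN12, hN21, hN22, hDdef, hDdef']
  linear_combination (-(sR * cR' - cR * sR') *
    (s0 * s0' * U11 - (s0 * c0' + c0 * s0') * U12 + c0 * c0' * U22)) * hW

end ResolventDifference

/-! ### The boundary data map and the spectral shift function -/

lemma hasDerivAt_bdryDet {R : ℝ} (hR : 0 ≤ R) {V : ℝ → ℂ} (hV : IntervalIntegrable V volume 0 R)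
    {u₁ du₁ u₂ du₂ : ℂ → ℝ → ℂ}
    (hu : ∀ w, IsFundamental R V w (u₁ w) (du₁ w) (u₂ w) (du₂ w)) {z : ℂ}
    (hc₁ : TendstoUniformlyOn u₁ (u₁ z) (nhds z) (Set.Icc 0 R))
    (hc₂ : TendstoUniformlyOn u₂ (u₂ z) (nhds z) (Set.Icc 0 R)) (t0 tR : ℂ) :
    HasDerivAt (fun w => bdryDet R t0 tR (u₁ w) (du₁ w) (u₂ w) (du₂ w))
      (bdryDetDeriv R t0 tR (u₁ z) (du₁ z) (u₂ z) (du₂ z)) z := by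
  have s₁ w := (hu w).sol₁.isSolOn hR hV
  have s₂ w := (hu w).sol₂.isSolOn hR hV
  have hW := (hu z).wronskian hR hV
  obtain ⟨a₁, b₁⟩ := hasDerivAt_isSolOn_right hR s₁ (fun w => (hu w).val₁)
    (fun w => (hu w).deriv₁) hc₁ (s₁ z) (s₂ z) hW
  obtain ⟨a₂, b₂⟩ := hasDerivAt_isSolOn_right hR s₂ (fun w => (hu w).val₂)
    (fun w => (hu w).deriv₂) hc₂ (s₁ z) (s₂ z) hW
  have hsymm : ∫ t in (0 : ℝ)..R, u₂ z t * u₁ z t = ∫ t in (0 : ℝ)..R, u₁ z t * u₂ z t := by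
    congr 1; funext t; ring
  rw [hsymm] at a₂ b₂
  simp only [(hu _).bdryDet_eq]
  refine ((((a₂.const_mul (Complex.cos tR)).sub (b₂.const_mul (Complex.sin tR))).const_mul
    (Complex.cos t0)).sub (((a₁.const_mul (Complex.cos tR)).sub
    (b₁.const_mul (Complex.sin tR))).const_mul (Complex.sin t0))).congr_deriv ?_
  unfold bdryDetDeriv
  ring

/-- The logarithmic derivative of the determinant of the boundary data map is minus the trace of
the resolvent difference. -/
lemma deriv_log_det_boundaryDataMap {R : ℝ} (hR : 0 < R) {V : ℝ → ℂ}
    (hV : IntervalIntegrable V volume 0 R) {t0 tR t0' tR' : ℂ} {A A' : SchSp R →ₗ.[ℂ] SchSp R}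
    (hA : IsSchrodingerOp R V t0 tR A) (hA' : IsSchrodingerOp R V t0' tR' A')
    (b : HilbertBasis ℕ ℂ (SchSp R)) {Λ : ℂ → Matrix (Fin 2) (Fin 2) ℂ} {L : ℂ → ℂ} {η z : ℂ}
    (hz : z ∈ resolventSetP A) (hz' : z ∈ resolventSetP A')
    (hΛ : ∀ᶠ w in nhds z, IsBoundaryDataMap R V t0 tR t0' tR' w (Λ w))
    (hL : DifferentiableAt ℂ L z)
    (hexp : ∀ᶠ w in nhds z, Complex.exp (L w) = η * (Λ w).det) :
    deriv L z = -traceH b (res A' z - res A z) := by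
  obtain ⟨u₁, du₁, h₁⟩ := exists_solODE hR.le hV 1 0
  obtain ⟨u₂, du₂, h₂⟩ := exists_solODE hR.le hV 0 1
  have hu w : IsFundamental R V w (u₁ w) (du₁ w) (u₂ w) (du₂ w) :=
    ⟨(h₁ w).1, (h₂ w).1, (h₁ w).2.1, (h₁ w).2.2.1, (h₂ w).2.1, (h₂ w).2.2.1⟩
  have hD := hasDerivAt_bdryDet hR.le hV hu (h₁ z).2.2.2 (h₂ z).2.2.2 t0 tR
  have hD' := hasDerivAt_bdryDet hR.le hV hu (h₁ z).2.2.2 (h₂ z).2.2.2 t0' tR'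
  have hne := (hu z).bdryDet_ne_zero hR hV hA hz
  have hne' := (hu z).bdryDet_ne_zero hR hV hA' hz'
  have htr := (hu z).bdryDet_mul_traceH hR hV hA hA' hz hz' b
  have heq : ∀ᶠ w in nhds z,
      Complex.exp (L w) * bdryDet R t0 tR (u₁ w) (du₁ w) (u₂ w) (du₂ w) =
        η * bdryDet R t0' tR' (u₁ w) (du₁ w) (u₂ w) (du₂ w) := by
    filter_upwards [hΛ, hexp] with w hw hw'
    rw [hw', mul_assoc, (hu w).det_mul_bdryDet hw]
  have hder := ((hL.hasDerivAt.cexp.mul hD).congr_of_eventuallyEq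
    (heq.mono fun w hw => hw.symm)).unique (hD'.const_mul η)
  have hval := heq.self_of_nhds
  refine mul_left_cancel₀ (mul_ne_zero (Complex.exp_ne_zero (L z)) (mul_ne_zero hne
    (mul_ne_zero hne hne'))) ?_
  set D := bdryDet R t0 tR (u₁ z) (du₁ z) (u₂ z) (du₂ z)
  set D' := bdryDet R t0' tR' (u₁ z) (du₁ z) (u₂ z) (du₂ z)
  linear_combination D * D' * hder + D * Complex.exp (L z) * htr -
    D * bdryDetDeriv R t0' tR' (u₁ z) (du₁ z) (u₂ z) (du₂ z) * hval

/-- Theorem 4.3: for a.e. `λ ∈ ℝ`, the spectral shift function of the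
pair `(H_{θ₀',θ_R'}, H_{θ₀,θ_R})` (normalized to vanish below `e₀` and satisfying Krein's
trace formula) is recovered as the boundary value
`ξ(λ) = π⁻¹ limₑ↓0 Im ln(η(θ₀,θ_R) det Λ_{θ₀,θ_R}^{θ₀',θ_R'}(λ + iε))`, where `ln` is the
branch of the logarithm on `ℂ \ [e₀,∞)` that is real on `(-∞, e₀)`. -/
theorem statement19
    (Rr : ℝ) (hR : 0 < Rr) (V : ℝ → ℝ)
    (hV : MeasureTheory.IntegrableOn V (Set.Ioo 0 Rr) MeasureTheory.volume)
    (t0 tR t0' tR' : ℝ)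
    (ht0 : t0 ∈ Set.Ico 0 Real.pi) (htR : tR ∈ Set.Ico 0 Real.pi)
    (ht0' : t0' ∈ Set.Ioo 0 Real.pi) (htR' : tR' ∈ Set.Ioo 0 Real.pi)
    (Hop Hop' : SchSp Rr →ₗ.[ℂ] SchSp Rr)
    (hHop : IsSchrodingerOp Rr (fun x => (V x : ℂ)) (t0 : ℂ) (tR : ℂ) Hop)
    (hHop' : IsSchrodingerOp Rr (fun x => (V x : ℂ)) (t0' : ℂ) (tR' : ℂ) Hop')
    (hsa : IsSelfAdjoint Hop) (hsa' : IsSelfAdjoint Hop')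
    (b : HilbertBasis ℕ ℂ (SchSp Rr))
    (Λ : ℂ → Matrix (Fin 2) (Fin 2) ℂ)
    (hΛ : ∀ z ∈ resolventSetP Hop,
      IsBoundaryDataMap Rr (fun x => (V x : ℂ)) (t0 : ℂ) (tR : ℂ) (t0' : ℂ) (tR' : ℂ) z (Λ z))
    (ξ : ℝ → ℝ)
    (hint : MeasureTheory.Integrable (fun lam : ℝ => ξ lam / (lam ^ 2 + 1)))
    (hnorm : ∀ lam : ℝ, lam < einf Rr Hop Hop' → ξ lam = 0)
    (hKrein : ∀ z ∈ resolventSetP Hop ∩ resolventSetP Hop',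
      traceH b (res Hop' z - res Hop z) =
        -∫ lam in Set.Ici (einf Rr Hop Hop'),
            ((ξ lam : ℂ) / (((lam : ℂ) - z) ^ 2)) ∂MeasureTheory.volume) :
    ∀ L : ℂ → ℂ,
      DifferentiableOn ℂ L (offCut (einf Rr Hop Hop')) →
      (∀ w ∈ offCut (einf Rr Hop Hop'),
        Complex.exp (L w) =
          ((if (t0 = 0 ∧ tR ≠ 0) ∨ (t0 ≠ 0 ∧ tR = 0) then (-1 : ℝ) else 1 : ℝ) : ℂ) *
            (Λ w).det) →
      (∀ x : ℝ, x < einf Rr Hop Hop' → (L (x : ℂ)).im = 0) →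
      ∀ᵐ lam : ℝ ∂MeasureTheory.volume,
        Filter.Tendsto (fun ε : ℝ => Real.pi⁻¹ * (L ((lam : ℂ) + (ε : ℂ) * Complex.I)).im)
          (nhdsWithin 0 (Set.Ioi 0)) (nhds (ξ lam)) := by
  intro L hL hexp hreal
  have hV' : IntervalIntegrable (fun x => (V x : ℂ)) volume 0 Rr :=
    (intervalIntegrable_iff_integrableOn_Ioo_of_le hR.le).2 hV.ofReal
  refine ae_tendsto_im_of_deriv_eq hint hnorm hL hreal fun z hz => ?_
  have hmem : ∀ w : ℂ, 0 < w.im → w ∈ resolventSetP Hop ∧ w ∈ resolventSetP Hop' := fun w hw =>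
    ⟨mem_resolventSetP_of_isSelfAdjoint hsa hw.ne', mem_resolventSetP_of_isSelfAdjoint hsa' hw.ne'⟩
  have hpos : ∀ᶠ w : ℂ in nhds z, 0 < w.im :=
    Complex.continuous_im.continuousAt.eventually (lt_mem_nhds hz)
  rw [deriv_log_det_boundaryDataMap hR hV' hHop hHop' b (hmem z hz).1 (hmem z hz).2
    (hpos.mono fun w hw => hΛ w (hmem w hw).1)
    (hL.differentiableAt ((isOpen_offCut _).mem_nhds (Or.inl hz.ne')))
    (hpos.mono fun w hw => hexp w (Or.inl hw.ne')), hKrein z (hmem z hz), neg_neg]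

end
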